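/- There is a constant C > 0, depending only on |𝒳| and |𝒴|, with the following property. Let n ≥ 27, set ε_n = n^{−1/(|𝒳||𝒴|+1)}, and let l ∈ ℕ₊. Let M_1,…,M_l, T be finitely supported random variables and 𝐗 a random variable on 𝒳^n and, for each channel w ∈ 𝒫(𝒴|𝒳), let 𝐘_w be an output of 𝐗 through w^n with (T, M_1,…,M_l) ⊸ 𝐗 ⊸ 𝐘_w. Then there exist: a finitely supported random variable U jointly distributed with (T, M_1,…,M_l, 𝐗) such that T is almost surely a deterministic function of U, (U, M_1,…,M_l) ⊸ 𝐗 ⊸ 𝐘_w for every w ∈ 𝒫(𝒴|𝒳), and log₂|𝒰| ≤ C·(log₂|𝒯| + l·n·ε_n·(−log₂ ε_n)); a real ν ∈ (0, C·(n^{−1}·log₂|𝒯| + l·√ε_n·(−log₂ ε_n))]; and a set 𝒰̃ of values of U with P(U ∈ 𝒰̃) ≥ 1 − C·l·2^{−n·ε_n}, such that for each j ∈ [1:l] and each u ∈ 𝒰̃ at least one of the following holds: (stable) for every w ∈ 𝒫(𝒴|𝒳), Pr((𝐘_w, M_1,…,M_l) ∈ D_stable,j(u,w;ν) | U=u) ≥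 1 − 8·2^{−n·ε_n}; or (saturate) for every w ∈ 𝒫(𝒴|𝒳), Pr((𝐘_w, M_1,…,M_l) ∈ D_sat,j(u,w;ν) | U=u) ≥ 1 − 8·2^{−n·ε_n}. Moreover, if M_j is uniformly distributed on its range, then the (stable) alternative holds for every u ∈ 𝒰̃. -/

import Mathlib

open scoped Classical BigOperators

noncomputable section

namespace Paper

variable {Ω : Type*}

/-- Probability of an event under a discrete probability distribution. -/
def pr (μ : PMF Ω) (E : Set Ω) : ℝ := (μ.toOuterMeasure E).toReal

/-- Conditional probability `Pr(E | F)`. -/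
def cpr (μ : PMF Ω) (E F : Set Ω) : ℝ := pr μ (E ∩ F) / pr μ F

/-- Entropy spectrum frequency `h_X(x) = -log₂ Pr(X = x)`. -/
def hs {α : Type*} (μ : PMF Ω) (X : Ω → α) (x : α) : ℝ :=
  - Real.logb 2 (pr μ {ω | X ω = x})

/-- Conditional entropy spectrum frequency `h_{X|Y}(x|y) = -log₂ Pr(X = x | Y = y)`. -/
def hcs {α β : Type*} (μ : PMF Ω) (X : Ω → α) (Y : Ω → β) (x : α) (y : β) : ℝ :=
  - Real.logb 2 (cpr μ {ω | X ω = x} {ω | Y ω = y})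

/-- Conditional Shannon entropy (bits) `H(X|Y)`. -/
def Hc {α β : Type*} [Fintype α] [Fintype β] (μ : PMF Ω) (X : Ω → α) (Y : Ω → β) : ℝ :=
  - ∑ x : α, ∑ y : β, pr μ ({ω | X ω = x} ∩ {ω | Y ω = y}) *
      Real.logb 2 (cpr μ {ω | X ω = x} {ω | Y ω = y})

/-- Shannon entropy (bits) of `X` conditioned on the event `E`. -/
def HEvt {α : Type*} [Fintype α] (μ : PMF Ω) (X : Ω → α) (E : Set Ω) : ℝ :=
  - ∑ x : α, cpr μ {ω | X ω = x} E * Real.logb 2 (cpr μ {ω | X ω = x} E)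

/-- Conditional Shannon entropy (bits) `H(X|Y)` computed given the event `E`. -/
def HcEvt {α β : Type*} [Fintype α] [Fintype β] (μ : PMF Ω) (X : Ω → α) (Y : Ω → β)
    (E : Set Ω) : ℝ :=
  - ∑ x : α, ∑ y : β, cpr μ ({ω | X ω = x} ∩ {ω | Y ω = y}) E *
      Real.logb 2 (cpr μ {ω | X ω = x} ({ω | Y ω = y} ∩ E))

/-- `A ⊸ B ⊸ C` : `A` and `C` are conditionally independent given `B`. -/
def Markov {α β γ : Type*} (μ : PMF Ω) (A : Ω → α) (B : Ω → β) (C : Ω → γ) : Prop :=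
  ∀ a b c, pr μ {ω | A ω = a ∧ B ω = b ∧ C ω = c} * pr μ {ω | B ω = b} =
    pr μ {ω | A ω = a ∧ B ω = b} * pr μ {ω | B ω = b ∧ C ω = c}

/-- A discrete memoryless channel from `𝒳` to `𝒴`. -/
structure Channel (𝒳 𝒴 : Type*) [Fintype 𝒴] where
  w : 𝒳 → 𝒴 → ℝ
  nonneg : ∀ x y, 0 ≤ w x y
  sum_one : ∀ x, ∑ y, w x y = 1

/-- The `n`-fold product channel `W^n(𝐲|𝐱)`. -/
def Channel.pn {𝒳 𝒴 : Type*} [Fintype 𝒴] (W : Channel 𝒳 𝒴) (n : ℕ)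
    (x : Fin n → 𝒳) (y : Fin n → 𝒴) : ℝ := ∏ i, W.w (x i) (y i)

/-- `Y` is an output of `X` through `W^n`. -/
def IsOutput {𝒳 𝒴 : Type*} [Fintype 𝒴] {n : ℕ} (μ : PMF Ω)
    (X : Ω → Fin n → 𝒳) (Y : Ω → Fin n → 𝒴) (W : Channel 𝒳 𝒴) : Prop :=
  ∀ x y, 0 < pr μ {ω | X ω = x} → cpr μ {ω | Y ω = y} {ω | X ω = x} = W.pn n x y

/-- `W^n(B|𝐱)`. -/
def imgMass {𝒳 𝒴 : Type*} [Fintype 𝒴] (W : Channel 𝒳 𝒴) (n : ℕ)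
    (x : Fin n → 𝒳) (B : Finset (Fin n → 𝒴)) : ℝ := ∑ y ∈ B, W.pn n x y

/-- `B` is an `η`-image of `A` by `W`. -/
def IsImage {𝒳 𝒴 : Type*} [Fintype 𝒴] (W : Channel 𝒳 𝒴) (n : ℕ)
    (A : Set (Fin n → 𝒳)) (η : ℝ) (B : Finset (Fin n → 𝒴)) : Prop :=
  ∀ x ∈ A, η ≤ imgMass W n x B

/-- Minimum cardinality of an `η`-image of `A` by `W`. -/
def gimg {𝒳 𝒴 : Type*} [Fintype 𝒴] (W : Channel 𝒳 𝒴) (n : ℕ)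
    (A : Set (Fin n → 𝒳)) (η : ℝ) : ℕ :=
  sInf {k | ∃ B : Finset (Fin n → 𝒴), IsImage W n A η B ∧ B.card = k}

/-- `B` is an `η`-quasi-image of the pmf `P` by `W`. -/
def IsQImage {𝒳 𝒴 : Type*} [Fintype 𝒳] [Fintype 𝒴] (W : Channel 𝒳 𝒴) (n : ℕ)
    (P : (Fin n → 𝒳) → ℝ) (η : ℝ) (B : Finset (Fin n → 𝒴)) : Prop :=
  η ≤ ∑ x, imgMass W n x B * P x

/-- Minimum cardinality of an `η`-quasi-image of `P` by `W`. -/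
def gqimg {𝒳 𝒴 : Type*} [Fintype 𝒳] [Fintype 𝒴] (W : Channel 𝒳 𝒴) (n : ℕ)
    (P : (Fin n → 𝒳) → ℝ) (η : ℝ) : ℕ :=
  sInf {k | ∃ B : Finset (Fin n → 𝒴), IsQImage W n P η B ∧ B.card = k}

/-- The number of values in the support of `U`. -/
def suppCard {α : Type*} [Fintype α] (μ : PMF Ω) (U : Ω → α) : ℕ :=
  (Finset.univ.filter (fun u => 0 < pr μ {ω | U ω = u})).card

/-- Mutual information (bits). -/
def MI {α β : Type*} [Fintype α] [Fintype β] (μ : PMF Ω) (A : Ω → α) (B : Ω → β) : ℝ :=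
  ∑ a : α, ∑ b : β, pr μ {ω | A ω = a ∧ B ω = b} *
    Real.logb 2 (pr μ {ω | A ω = a ∧ B ω = b} / (pr μ {ω | A ω = a} * pr μ {ω | B ω = b}))

/-- Conditional mutual information (bits). -/
def CMI {α β γ : Type*} [Fintype α] [Fintype β] [Fintype γ] (μ : PMF Ω)
    (A : Ω → α) (B : Ω → β) (C : Ω → γ) : ℝ :=
  ∑ c : γ, pr μ {ω | C ω = c} * ∑ a : α, ∑ b : β,
    cpr μ {ω | A ω = a ∧ B ω = b} {ω | C ω = c} *
      Real.logb 2 (cpr μ {ω | A ω = a ∧ B ω = b} {ω | C ω = c} /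
        (cpr μ {ω | A ω = a} {ω | C ω = c} * cpr μ {ω | B ω = b} {ω | C ω = c}))

/-- `D_{wh}(w‖w'|p̂)` in the extended reals, with the stated conventions. -/
def Dkl {𝒳 𝒴 : Type*} [Fintype 𝒳] [Fintype 𝒴] (w w' wh : Channel 𝒳 𝒴)
    (p : 𝒳 → ℝ) : EReal :=
  if ∃ x y, 0 < wh.w x y * p x ∧ w'.w x y = 0 ∧ 0 < w.w x y then ⊤
  else if ∃ x y, 0 < wh.w x y * p x ∧ w.w x y = 0 ∧ 0 < w'.w x y then ⊥
  else ((∑ x : 𝒳, ∑ y : 𝒴, wh.w x y * p x * Real.logb 2 (w.w x y / w'.w x y) : ℝ) : EReal)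

/-- `sup { D_{wh}(w‖w'|p̂) }` over channels `wh` and pmfs `p̂` on `𝒳`. -/
def DklSup {𝒳 𝒴 : Type*} [Fintype 𝒳] [Fintype 𝒴] (w w' : Channel 𝒳 𝒴) : EReal :=
  sSup {d : EReal | ∃ (wh : Channel 𝒳 𝒴) (p : 𝒳 → ℝ),
    (∀ x, 0 ≤ p x) ∧ (∑ x, p x = 1) ∧ d = Dkl w w' wh p}


section Probability

variable (μ : PMF Ω)

lemma pr_nonneg (E : Set Ω) : 0 ≤ pr μ E := ENNReal.toReal_nonneg

lemma outer_le_one (E : Set Ω) : μ.toOuterMeasure E ≤ 1 := by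
  rw [PMF.toOuterMeasure_apply, ← μ.tsum_coe]
  exact ENNReal.tsum_le_tsum fun ω => Set.indicator_le_self _ _ _

lemma outer_ne_top (E : Set Ω) : μ.toOuterMeasure E ≠ ⊤ :=
  ne_top_of_le_ne_top ENNReal.one_ne_top (outer_le_one μ E)

lemma pr_mono {E F : Set Ω} (h : E ⊆ F) : pr μ E ≤ pr μ F :=
  ENNReal.toReal_mono (outer_ne_top μ F) (μ.toOuterMeasure.mono h)

lemma pr_univ : pr μ Set.univ = 1 := by
  simp [pr, PMF.toOuterMeasure_apply, μ.tsum_coe]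

lemma pr_eq_sum_inter {α : Type*} [Fintype α] (V : Ω → α) (E : Set Ω) :
    pr μ E = ∑ a, pr μ (E ∩ {ω | V ω = a}) := by
  unfold pr
  rw [← ENNReal.toReal_sum fun a _ => outer_ne_top μ _]
  congr 1
  simp only [PMF.toOuterMeasure_apply]
  rw [← Summable.tsum_finsetSum fun _ _ => ENNReal.summable]
  congr 1
  funext ω
  by_cases h : ω ∈ E <;> simp [Set.indicator, h]

lemma pr_setOf_comp {α : Type*} [Fintype α] (V : Ω → α) (E : Set Ω) (Q : α → Prop) :
    pr μ ({ω | Q (V ω)} ∩ E) = ∑ a, if Q a then pr μ (E ∩ {ω | V ω = a}) else 0 := by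
  rw [pr_eq_sum_inter μ V]
  refine Finset.sum_congr rfl fun a _ => ?_
  split_ifs with h
  · congr 1
    ext ω
    simp only [Set.mem_inter_iff, Set.mem_ofPred_eq]
    constructor
    · tauto
    · rintro ⟨h1, rfl⟩
      exact ⟨⟨h, h1⟩, rfl⟩
  · have : {ω | Q (V ω)} ∩ E ∩ {ω | V ω = a} = ∅ := by
      ext ω
      simp only [Set.mem_inter_iff, Set.mem_ofPred_eq, Set.mem_empty_iff_false, iff_false]
      rintro ⟨⟨h1, _⟩, rfl⟩
      exact h h1
    simp [this, pr]

end Probability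

section BoundedDifferences

variable {𝒴 : Type*}

/-- Changing one coordinate changes `f` by at most `L`. -/
def BoundedDiff {n : ℕ} (L : ℝ) (f : (Fin n → 𝒴) → ℝ) : Prop :=
  ∀ y i c, |f (Function.update y i c) - f y| ≤ L

lemma BoundedDiff.cons {n : ℕ} {L : ℝ} {f : (Fin (n + 1) → 𝒴) → ℝ} (h : BoundedDiff L f)
    (b : 𝒴) : BoundedDiff L (fun z : Fin n → 𝒴 => f (Fin.cons b z)) := by
  intro z i c
  have := h (Fin.cons b z : Fin (n + 1) → 𝒴) i.succ c
  rwa [← Fin.cons_update] at this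

lemma BoundedDiff.neg {n : ℕ} {L : ℝ} {f : (Fin n → 𝒴) → ℝ} (h : BoundedDiff L f) :
    BoundedDiff L (fun y => -f y) := by
  intro y i c
  rw [← abs_neg]
  convert h y i c using 2
  ring

variable [Fintype 𝒴]

/-- Expectation of `f` under the product of the weights `v i`. -/
def prodExp {n : ℕ} (v : Fin n → 𝒴 → ℝ) (f : (Fin n → 𝒴) → ℝ) : ℝ :=
  ∑ y, (∏ i, v i (y i)) * f y

/-- Each `v i` is a probability vector. -/
def IsWeights {n : ℕ} (v : Fin n → 𝒴 → ℝ) : Prop :=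
  ∀ i, (∀ b, 0 ≤ v i b) ∧ ∑ b, v i b = 1

lemma IsWeights.tail {n : ℕ} {v : Fin (n + 1) → 𝒴 → ℝ} (h : IsWeights v) :
    IsWeights (fun i => v (Fin.succ i)) := fun i => h i.succ

lemma prodExp_succ {n : ℕ} (v : Fin (n + 1) → 𝒴 → ℝ) (f : (Fin (n + 1) → 𝒴) → ℝ) :
    prodExp v f =
      ∑ b, v 0 b * prodExp (fun i => v (Fin.succ i)) (fun z => f (Fin.cons b z)) := by
  unfold prodExp
  rw [← (Fin.consEquiv (fun _ : Fin (n + 1) => 𝒴)).sum_comp, Fintype.sum_prod_type]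
  refine Finset.sum_congr rfl fun b _ => ?_
  rw [Finset.mul_sum]
  refine Finset.sum_congr rfl fun z _ => ?_
  simp [Fin.consEquiv, Fin.prod_univ_succ, mul_assoc]

lemma prodExp_const {n : ℕ} {v : Fin n → 𝒴 → ℝ} (hv : IsWeights v) (c : ℝ) :
    prodExp v (fun _ => c) = c := by
  induction n with
  | zero => simp [prodExp]
  | succ n ih =>
    rw [prodExp_succ, ih hv.tail, ← Finset.sum_mul, (hv 0).2, one_mul]

lemma prodExp_mono {n : ℕ} {v : Fin n → 𝒴 → ℝ} (hv : IsWeights v) {f g : (Fin n → 𝒴) → ℝ}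
    (h : ∀ y, f y ≤ g y) : prodExp v f ≤ prodExp v g :=
  Finset.sum_le_sum fun y _ =>
    mul_le_mul_of_nonneg_left (h y) (Finset.prod_nonneg fun i _ => (hv i).1 _)

lemma prodExp_const_mul {n : ℕ} (v : Fin n → 𝒴 → ℝ) (f : (Fin n → 𝒴) → ℝ) (c : ℝ) :
    prodExp v (fun y => c * f y) = c * prodExp v f := by
  unfold prodExp
  rw [Finset.mul_sum]
  exact Finset.sum_congr rfl fun y _ => by ring

lemma prodExp_neg {n : ℕ} (v : Fin n → 𝒴 → ℝ) (f : (Fin n → 𝒴) → ℝ) :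
    prodExp v (fun y => -f y) = -prodExp v f := by
  simpa using prodExp_const_mul v f (-1)

lemma prodExp_add {n : ℕ} (v : Fin n → 𝒴 → ℝ) (f g : (Fin n → 𝒴) → ℝ) :
    prodExp v (fun y => f y + g y) = prodExp v f + prodExp v g := by
  simp [prodExp, mul_add, Finset.sum_add_distrib]

lemma prodExp_cons_sub_le {n : ℕ} {L : ℝ} {v : Fin n → 𝒴 → ℝ} (hv : IsWeights v)
    {f : (Fin (n + 1) → 𝒴) → ℝ} (hf : BoundedDiff L f) (b c : 𝒴) :
    prodExp v (fun z => f (Fin.cons b z)) - prodExp v (fun z => f (Fin.cons c z)) ≤ L := by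
  have : prodExp v (fun z => f (Fin.cons b z)) ≤
      prodExp v (fun z => f (Fin.cons c z) + L) := by
    refine prodExp_mono hv fun z => ?_
    have := (abs_le.1 (hf (Fin.cons c z : Fin (n + 1) → 𝒴) 0 b)).2
    rw [Fin.update_cons_zero] at this
    linarith
  rw [prodExp_add, prodExp_const hv] at this
  linarith

lemma sum_mul_exp_centered_le {q g : 𝒴 → ℝ} (hq : ∀ b, 0 ≤ q b) (hq1 : ∑ b, q b = 1)
    {L : ℝ} (hL : 0 < L) (hg : ∀ b c, g b - g c ≤ L) (s : ℝ) :
    ∑ b, q b * Real.exp (s * (g b - ∑ c, q c * g c)) ≤ Real.exp (s ^ 2 * L ^ 2 / 2) := by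
  set e := ∑ c, q c * g c with he
  have hbd : ∀ b, |g b - e| ≤ L := by
    intro b
    have h1 : g b - e = ∑ c, q c * (g b - g c) := by
      simp [mul_sub, ← Finset.sum_mul, hq1, he]
    rw [h1, abs_le]
    constructor
    · calc -L = ∑ c, q c * (-L) := by rw [← Finset.sum_mul, hq1, one_mul]
        _ ≤ _ := Finset.sum_le_sum fun c _ =>
          mul_le_mul_of_nonneg_left (by linarith [hg c b]) (hq c)
    · calc _ ≤ ∑ c, q c * L := Finset.sum_le_sum fun c _ =>
            mul_le_mul_of_nonneg_left (hg b c) (hq c)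
        _ = L := by rw [← Finset.sum_mul, hq1, one_mul]
  have hpt : ∀ b, Real.exp (s * (g b - e)) ≤
      Real.cosh (s * L) + (g b - e) / L * Real.sinh (s * L) := by
    intro b
    obtain ⟨h1, h2⟩ := abs_le.1 (hbd b)
    set t := (g b - e) / L with ht
    have ht1 : -1 ≤ t := by rw [ht, le_div_iff₀ hL]; linarith
    have ht2 : t ≤ 1 := by rw [ht, div_le_iff₀ hL]; linarith
    have hge : g b - e = t * L := by rw [ht]; field_simp
    have := convexOn_exp.2 (Set.mem_univ (s * L)) (Set.mem_univ (-(s * L)))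
      (show 0 ≤ (1 + t) / 2 by linarith) (show 0 ≤ (1 - t) / 2 by linarith) (by ring)
    simp only [smul_eq_mul] at this
    rw [hge, Real.cosh_eq, Real.sinh_eq]
    calc Real.exp (s * (t * L))
        = Real.exp ((1 + t) / 2 * (s * L) + (1 - t) / 2 * (-(s * L))) := by congr 1; ring
      _ ≤ _ := this
      _ = _ := by ring
  calc ∑ b, q b * Real.exp (s * (g b - e))
      ≤ ∑ b, q b * (Real.cosh (s * L) + (g b - e) / L * Real.sinh (s * L)) :=
        Finset.sum_le_sum fun b _ => mul_le_mul_of_nonneg_left (hpt b) (hq b)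
    _ = (∑ b, q b) * Real.cosh (s * L) +
          (∑ b, q b * g b - (∑ b, q b) * e) * (Real.sinh (s * L) / L) := by
        rw [Finset.sum_mul, Finset.sum_mul, ← Finset.sum_sub_distrib, Finset.sum_mul,
          ← Finset.sum_add_distrib]
        exact Finset.sum_congr rfl fun b _ => by ring
    _ = Real.cosh (s * L) := by rw [hq1, ← he]; ring
    _ ≤ Real.exp ((s * L) ^ 2 / 2) := Real.cosh_le_exp_half_sq _
    _ = _ := by congr 1; ring

lemma prodExp_exp_centered_le {n : ℕ} {L : ℝ} (hL : 0 < L) {v : Fin n → 𝒴 → ℝ}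
    (hv : IsWeights v) {f : (Fin n → 𝒴) → ℝ} (hf : BoundedDiff L f) (s : ℝ) :
    prodExp v (fun y => Real.exp (s * (f y - prodExp v f))) ≤
      Real.exp (n * (s ^ 2 * L ^ 2 / 2)) := by
  induction n with
  | zero => simp [prodExp]
  | succ n ih =>
    set g : 𝒴 → ℝ := fun b => prodExp (fun i => v (Fin.succ i)) (fun z => f (Fin.cons b z))
      with hg
    have hE : prodExp v f = ∑ b, v 0 b * g b := prodExp_succ v f
    rw [prodExp_succ, hE]
    calc ∑ b, v 0 b * prodExp (fun i => v (Fin.succ i))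
          (fun z => Real.exp (s * (f (Fin.cons b z) - ∑ c, v 0 c * g c)))
        = ∑ b, v 0 b * (Real.exp (s * (g b - ∑ c, v 0 c * g c)) *
            prodExp (fun i => v (Fin.succ i))
              (fun z => Real.exp (s * (f (Fin.cons b z) - g b)))) := by
          refine Finset.sum_congr rfl fun b _ => ?_
          congr 1
          rw [← prodExp_const_mul]
          congr 1
          funext z
          rw [← Real.exp_add]
          congr 1
          ring
      _ ≤ ∑ b, v 0 b * (Real.exp (s * (g b - ∑ c, v 0 c * g c)) *
            Real.exp (n * (s ^ 2 * L ^ 2 / 2))) := by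
          refine Finset.sum_le_sum fun b _ => mul_le_mul_of_nonneg_left ?_ ((hv 0).1 b)
          exact mul_le_mul_of_nonneg_left (ih hv.tail (hf.cons b)) (Real.exp_nonneg _)
      _ = (∑ b, v 0 b * Real.exp (s * (g b - ∑ c, v 0 c * g c))) *
            Real.exp (n * (s ^ 2 * L ^ 2 / 2)) := by
          rw [Finset.sum_mul]
          exact Finset.sum_congr rfl fun b _ => by ring
      _ ≤ Real.exp (s ^ 2 * L ^ 2 / 2) * Real.exp (n * (s ^ 2 * L ^ 2 / 2)) := by
          refine mul_le_mul_of_nonneg_right ?_ (Real.exp_nonneg _)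
          exact sum_mul_exp_centered_le (hv 0).1 (hv 0).2 hL
            (fun b c => prodExp_cons_sub_le hv.tail hf b c) s
      _ = _ := by
          rw [← Real.exp_add]
          congr 1
          push_cast
          ring

lemma two_rpow_neg_ge_exp {a : ℝ} (ha : 0 ≤ a) : Real.exp (-(2 * a)) ≤ (2 : ℝ) ^ (-a) := by
  rw [Real.rpow_def_of_pos two_pos]
  apply Real.exp_le_exp.2
  nlinarith [Real.log_two_lt_d9]

lemma prodExp_upper_tail {n : ℕ} {L : ℝ} (hL : 0 < L) {v : Fin n → 𝒴 → ℝ}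
    (hv : IsWeights v) {f : (Fin n → 𝒴) → ℝ} (hf : BoundedDiff L f) {ε : ℝ} (hε : 0 ≤ ε) :
    prodExp v (fun y => if 2 * n * L * √ε < f y - prodExp v f then 1 else 0) ≤
      2 ^ (-(n * ε)) := by
  set s := 2 * √ε / L with hs
  have hs0 : 0 ≤ s := by positivity
  have h1 : prodExp v (fun y => if 2 * n * L * √ε < f y - prodExp v f then 1 else 0) ≤
      prodExp v (fun y => Real.exp (-(s * (2 * n * L * √ε))) *
        Real.exp (s * (f y - prodExp v f))) := by
    refine prodExp_mono hv fun y => ?_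
    rw [← Real.exp_add]
    split_ifs with h
    · apply Real.one_le_exp
      nlinarith [mul_le_mul_of_nonneg_left h.le hs0]
    · exact Real.exp_nonneg _
  refine h1.trans ?_
  rw [prodExp_const_mul]
  refine (mul_le_mul_of_nonneg_left (prodExp_exp_centered_le hL hv hf s)
    (Real.exp_nonneg _)).trans ?_
  refine le_trans (le_of_eq ?_) (two_rpow_neg_ge_exp (a := n * ε) (by positivity))
  rw [← Real.exp_add]
  congr 1
  have h2 : s * L = 2 * √ε := by rw [hs]; field_simp
  have h3 : √ε * √ε = ε := Real.mul_self_sqrt hε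
  calc _ = -(2 * n * (s * L) * √ε) + n * ((s * L) ^ 2 / 2) := by ring
    _ = -(2 * (n * (√ε * √ε))) := by rw [h2]; ring
    _ = _ := by rw [h3]

lemma prodExp_two_sided_tail {n : ℕ} {L : ℝ} (hL : 0 < L) {v : Fin n → 𝒴 → ℝ}
    (hv : IsWeights v) {f : (Fin n → 𝒴) → ℝ} (hf : BoundedDiff L f) {ε : ℝ} (hε : 0 ≤ ε) :
    prodExp v (fun y => if 2 * n * L * √ε < |f y - prodExp v f| then 1 else 0) ≤
      2 * 2 ^ (-(n * ε)) := by
  have h1 := prodExp_upper_tail hL hv hf hε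
  have h2 := prodExp_upper_tail hL hv hf.neg hε
  rw [two_mul (2 ^ _ : ℝ)]
  refine le_trans ?_ (add_le_add h1 h2)
  rw [← prodExp_add]
  refine prodExp_mono hv fun y => ?_
  rw [prodExp_neg]
  by_cases h : 2 * n * L * √ε < |f y - prodExp v f|
  · rcases lt_abs.1 h with h' | h'
    · rw [if_pos h, if_pos h']
      split_ifs <;> norm_num
    · rw [if_pos h, if_pos (show 2 * n * L * √ε < -f y - -prodExp v f by linarith)]
      split_ifs <;> norm_num
  · rw [if_neg h]
    split_ifs <;> norm_num

lemma abs_prodExp_sub_le {n : ℕ} {L η : ℝ} {v v' : Fin n → 𝒴 → ℝ}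
    (hv : IsWeights v) (hv' : IsWeights v') (hle : ∀ i b, (1 - η) * v i b ≤ v' i b)
    {f : (Fin n → 𝒴) → ℝ} (hf : BoundedDiff L f) :
    |prodExp v f - prodExp v' f| ≤ n * L * η := by
  induction n with
  | zero => simp [prodExp]
  | succ n ih =>
    set g : 𝒴 → ℝ := fun b => prodExp (fun i => v (Fin.succ i)) (fun z => f (Fin.cons b z))
      with hg
    set g' : 𝒴 → ℝ := fun b => prodExp (fun i => v' (Fin.succ i)) (fun z => f (Fin.cons b z))
      with hg'
    have hE : prodExp v f = ∑ b, v 0 b * g b := prodExp_succ v f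
    have hE' : prodExp v' f = ∑ b, v' 0 b * g' b := prodExp_succ v' f
    have h1 : |∑ b, v' 0 b * (g b - g' b)| ≤ n * L * η := by
      refine (Finset.abs_sum_le_sum_abs _ _).trans ?_
      calc ∑ b, |v' 0 b * (g b - g' b)| ≤ ∑ b, v' 0 b * (n * L * η) := by
            refine Finset.sum_le_sum fun b _ => ?_
            rw [abs_mul, abs_of_nonneg ((hv' 0).1 b)]
            exact mul_le_mul_of_nonneg_left
              (ih hv.tail hv'.tail (fun i b => hle i.succ b) (hf.cons b)) ((hv' 0).1 b)
        _ = _ := by rw [← Finset.sum_mul, (hv' 0).2, one_mul]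
    set u : 𝒴 → ℝ := fun b => v' 0 b - (1 - η) * v 0 b with hu
    have hu0 : ∀ b, 0 ≤ u b := fun b => by simpa [hu] using hle 0 b
    have hu1 : ∑ b, u b = η := by
      simp [hu, Finset.sum_sub_distrib, ← Finset.mul_sum, (hv 0).2, (hv' 0).2]
    have h2 : |∑ b, (v 0 b - v' 0 b) * g b| ≤ L * η := by
      have h3 : ∑ b, (v 0 b - v' 0 b) * g b = ∑ b, ∑ c, u b * (v 0 c * (g c - g b)) := by
        have h4 : ∀ b, ∑ c, u b * (v 0 c * (g c - g b)) =
            u b * (∑ c, v 0 c * g c) - u b * g b := by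
          intro b
          rw [← Finset.mul_sum]
          simp only [mul_sub, Finset.sum_sub_distrib, ← Finset.sum_mul, (hv 0).2, one_mul]
        simp only [h4, Finset.sum_sub_distrib, ← Finset.sum_mul, hu1]
        rw [Finset.mul_sum, ← Finset.sum_sub_distrib]
        refine Finset.sum_congr rfl fun b _ => ?_
        simp only [hu]
        ring
      rw [h3]
      refine (Finset.abs_sum_le_sum_abs _ _).trans ?_
      calc ∑ b, |∑ c, u b * (v 0 c * (g c - g b))| ≤ ∑ b, u b * L := by
            refine Finset.sum_le_sum fun b _ => ?_
            rw [← Finset.mul_sum, abs_mul, abs_of_nonneg (hu0 b)]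
            refine mul_le_mul_of_nonneg_left ?_ (hu0 b)
            refine (Finset.abs_sum_le_sum_abs _ _).trans ?_
            calc ∑ c, |v 0 c * (g c - g b)| ≤ ∑ c, v 0 c * L := by
                  refine Finset.sum_le_sum fun c _ => ?_
                  rw [abs_mul, abs_of_nonneg ((hv 0).1 c)]
                  refine mul_le_mul_of_nonneg_left ?_ ((hv 0).1 c)
                  rw [abs_le]
                  constructor <;>
                    linarith [prodExp_cons_sub_le hv.tail hf b c,
                      prodExp_cons_sub_le hv.tail hf c b]
              _ = L := by rw [← Finset.sum_mul, (hv 0).2, one_mul]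
        _ = L * η := by rw [← Finset.sum_mul, hu1, mul_comm]
    have h5 : prodExp v f - prodExp v' f =
        ∑ b, (v 0 b - v' 0 b) * g b + ∑ b, v' 0 b * (g b - g' b) := by
      rw [hE, hE', ← Finset.sum_add_distrib, ← Finset.sum_sub_distrib]
      exact Finset.sum_congr rfl fun b _ => by ring
    rw [h5]
    refine (abs_add_le _ _).trans ((add_le_add h2 h1).trans (le_of_eq ?_))
    push_cast
    ring

end BoundedDifferences

section LikelihoodRatio

variable {ι : Type*} {b q : ι → ℝ} {ρ K : ℝ}

lemma neg_logb_div_le_llr (hK : 0 < K) (hρ : 0 < ρ) {i : ι} (hb : 0 < b i)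
    (h : b i ≤ K * q i) : -Real.logb 2 (K / ρ) ≤ Real.logb 2 (q i * ρ / b i) := by
  rw [← Real.logb_inv, inv_div]
  refine Real.logb_le_logb_of_le one_lt_two (by positivity) ?_
  rw [div_le_div_iff₀ hK hb]
  nlinarith

variable [Fintype ι]

lemma sum_llr_gt_le (hK : 0 < K) (hρ : 0 < ρ) (hbq : ∀ i, b i ≤ K * q i)
    (hq0 : ∀ i, 0 ≤ q i) (hq1 : ∑ i, q i ≤ 1) (τ : ℝ) :
    ∑ i, (if 0 < b i ∧ τ < Real.logb 2 (q i * ρ / b i) then b i else 0) ≤ 2 ^ (-τ) * ρ := by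
  calc _ ≤ ∑ i, 2 ^ (-τ) * ρ * q i := by
        refine Finset.sum_le_sum fun i _ => ?_
        split_ifs with h
        · obtain ⟨h2, h1⟩ := h
          have hq : 0 < q i := pos_of_mul_pos_right (h2.trans_le (hbq i)) hK.le
          rw [Real.lt_logb_iff_rpow_lt one_lt_two (by positivity), lt_div_iff₀ h2] at h1
          rw [Real.rpow_neg zero_le_two]
          have h5 : (0 : ℝ) < 2 ^ τ := by positivity
          rw [mul_assoc, inv_mul_eq_div, le_div_iff₀ h5]
          linarith
        · exact mul_nonneg (by positivity) (hq0 i)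
    _ = 2 ^ (-τ) * ρ * ∑ i, q i := by rw [Finset.mul_sum]
    _ ≤ _ := mul_le_of_le_one_right (by positivity) hq1

lemma sum_mul_llr_nonpos (hK : 0 < K) (hb0 : ∀ i, 0 ≤ b i) (hbq : ∀ i, b i ≤ K * q i)
    (hq0 : ∀ i, 0 ≤ q i) (hq1 : ∑ i, q i ≤ 1) (hρb : ∑ i, b i = ρ) (hρ : 0 < ρ) :
    ∑ i, b i * Real.logb 2 (q i * ρ / b i) ≤ 0 := by
  have h2 : 0 < Real.log 2 := Real.log_pos one_lt_two
  calc _ ≤ ∑ i, (q i * ρ - b i) / Real.log 2 := by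
        refine Finset.sum_le_sum fun i _ => ?_
        rcases (hb0 i).lt_or_eq with h | h
        · have hq : 0 < q i := pos_of_mul_pos_right (h.trans_le (hbq i)) hK.le
          have := Real.log_le_sub_one_of_pos (show 0 < q i * ρ / b i by positivity)
          rw [Real.logb, ← mul_div_assoc]
          refine div_le_div_of_nonneg_right ?_ h2.le
          calc _ ≤ b i * (q i * ρ / b i - 1) := mul_le_mul_of_nonneg_left this h.le
            _ = _ := by field_simp
        · rw [← h]
          simpa using div_nonneg (mul_nonneg (hq0 i) hρ.le) h2.le
    _ = ((∑ i, q i) * ρ - ρ) / Real.log 2 := by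
        rw [← Finset.sum_div, Finset.sum_sub_distrib, ← Finset.sum_mul, hρb]
    _ ≤ 0 := div_nonpos_of_nonpos_of_nonneg (by nlinarith) h2.le

lemma le_sum_mul_llr (hK : 0 < K) (hb0 : ∀ i, 0 ≤ b i) (hbq : ∀ i, b i ≤ K * q i)
    (hρb : ∑ i, b i = ρ) (hρ : 0 < ρ) :
    -(ρ * Real.logb 2 (K / ρ)) ≤ ∑ i, b i * Real.logb 2 (q i * ρ / b i) := by
  calc _ = ∑ i, b i * -Real.logb 2 (K / ρ) := by rw [← Finset.sum_mul, hρb]; ring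
    _ ≤ _ := by
        refine Finset.sum_le_sum fun i _ => ?_
        rcases (hb0 i).lt_or_eq with h | h
        · exact mul_le_mul_of_nonneg_left (neg_logb_div_le_llr hK hρ h (hbq i)) h.le
        · simp [← h]

end LikelihoodRatio

section ProductChannel

variable {𝒳 𝒴 : Type*} [Fintype 𝒴]

lemma Channel.isWeights (W : Channel 𝒳 𝒴) {n : ℕ} (x : Fin n → 𝒳) :
    IsWeights (fun i => W.w (x i)) := fun i => ⟨W.nonneg (x i), W.sum_one (x i)⟩

lemma Channel.pn_nonneg (W : Channel 𝒳 𝒴) {n : ℕ} (x : Fin n → 𝒳) (y : Fin n → 𝒴) :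
    0 ≤ W.pn n x y := Finset.prod_nonneg fun _ _ => W.nonneg _ _

lemma Channel.sum_pn_mul (W : Channel 𝒳 𝒴) {n : ℕ} (x : Fin n → 𝒳) (f : (Fin n → 𝒴) → ℝ) :
    ∑ y, W.pn n x y * f y = prodExp (fun i => W.w (x i)) f := rfl

lemma Channel.w_le_one (W : Channel 𝒳 𝒴) (x : 𝒳) (y : 𝒴) : W.w x y ≤ 1 := by
  rw [← W.sum_one x]
  exact Finset.single_le_sum (fun b _ => W.nonneg x b) (Finset.mem_univ y)

lemma Channel.pn_le_one (W : Channel 𝒳 𝒴) {n : ℕ} (x : Fin n → 𝒳) (y : Fin n → 𝒴) :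
    W.pn n x y ≤ 1 := Finset.prod_le_one (fun _ _ => W.nonneg _ _) fun _ _ => W.w_le_one _ _

lemma Channel.inv_pow_le_pn {W : Channel 𝒳 𝒴} {D : ℝ} (hD : 0 < D) (hW : ∀ x y, D⁻¹ ≤ W.w x y)
    {n : ℕ} (x : Fin n → 𝒳) (y : Fin n → 𝒴) : D⁻¹ ^ n ≤ W.pn n x y := by
  calc D⁻¹ ^ n = ∏ _i : Fin n, D⁻¹ := by simp
    _ ≤ _ := Finset.prod_le_prod (fun _ _ => by positivity) fun i _ => hW _ _

lemma Channel.pow_mul_pn_le {W W' : Channel 𝒳 𝒴} {c : ℝ} (hc : 0 ≤ c)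
    (hW : ∀ x y, c * W.w x y ≤ W'.w x y) {n : ℕ} (x : Fin n → 𝒳) (y : Fin n → 𝒴) :
    c ^ n * W.pn n x y ≤ W'.pn n x y := by
  calc c ^ n * W.pn n x y = ∏ i : Fin n, c * W.w (x i) (y i) := by
        simp [Finset.prod_mul_distrib, Channel.pn]
    _ ≤ _ := Finset.prod_le_prod (fun _ _ => mul_nonneg hc (W.nonneg _ _)) fun i _ => hW _ _

lemma Channel.pn_update_le {W : Channel 𝒳 𝒴} {D : ℝ} (hD : 0 < D)
    (hW : ∀ x y, D⁻¹ ≤ W.w x y) {n : ℕ} (x : Fin n → 𝒳) (y : Fin n → 𝒴) (i : Fin n) (c : 𝒴) :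
    W.pn n x (Function.update y i c) ≤ D * W.pn n x y := by
  unfold Channel.pn
  rw [← Finset.mul_prod_erase _ _ (Finset.mem_univ i),
    ← Finset.mul_prod_erase _ (fun j => W.w (x j) (y j)) (Finset.mem_univ i)]
  have h1 : ∏ j ∈ Finset.univ.erase i, W.w (x j) (Function.update y i c j) =
      ∏ j ∈ Finset.univ.erase i, W.w (x j) (y j) :=
    Finset.prod_congr rfl fun j hj => by
      rw [Function.update_of_ne (Finset.ne_of_mem_erase hj)]
  rw [h1, ← mul_assoc]
  refine mul_le_mul_of_nonneg_right ?_ (Finset.prod_nonneg fun _ _ => W.nonneg _ _)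
  calc _ ≤ 1 := W.w_le_one _ _
    _ = D * D⁻¹ := by field_simp
    _ ≤ _ := mul_le_mul_of_nonneg_left (hW _ _) hD.le

end ProductChannel

section Spectrum

variable {𝓜 𝒳 𝒴 : Type*} [Fintype 𝒳] {n : ℕ}

/-- Marginal of `p` on the messages. -/
def inMass (p : 𝓜 → (Fin n → 𝒳) → ℝ) (m : 𝓜) : ℝ := ∑ x, p m x

variable [Fintype 𝒴]

/-- Joint mass of the message and the output of `W` when `p` is the joint mass of the message and
the input. -/
def outMass (W : Channel 𝒳 𝒴) (p : 𝓜 → (Fin n → 𝒳) → ℝ) (m : 𝓜) (y : Fin n → 𝒴) : ℝ :=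
  ∑ x, p m x * W.pn n x y

/-- Conditional entropy spectrum of the output given the message. -/
def spec (W : Channel 𝒳 𝒴) (p : 𝓜 → (Fin n → 𝒳) → ℝ) (m : 𝓜) (y : Fin n → 𝒴) : ℝ :=
  -Real.logb 2 (outMass W p m y / inMass p m)

variable {W W' : Channel 𝒳 𝒴} {p r : 𝓜 → (Fin n → 𝒳) → ℝ}

lemma outMass_nonneg (hp : ∀ m x, 0 ≤ p m x) (m : 𝓜) (y : Fin n → 𝒴) :
    0 ≤ outMass W p m y :=
  Finset.sum_nonneg fun x _ => mul_nonneg (hp m x) (W.pn_nonneg x y)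

lemma inMass_nonneg (hp : ∀ m x, 0 ≤ p m x) (m : 𝓜) : 0 ≤ inMass p m :=
  Finset.sum_nonneg fun x _ => hp m x

lemma sum_outMass_mul (f : (Fin n → 𝒴) → ℝ) (m : 𝓜) :
    ∑ y, outMass W p m y * f y = ∑ x, p m x * prodExp (fun i => W.w (x i)) f := by
  simp only [outMass, Finset.sum_mul]
  rw [Finset.sum_comm]
  refine Finset.sum_congr rfl fun x _ => ?_
  rw [← W.sum_pn_mul, Finset.mul_sum]
  exact Finset.sum_congr rfl fun y _ => by ring

lemma sum_outMass (m : 𝓜) : ∑ y, outMass W p m y = inMass p m := by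
  have := sum_outMass_mul (W := W) (p := p) (fun _ => 1) m
  simpa [prodExp_const (W.isWeights _), inMass] using this

lemma outMass_le_inMass (hp : ∀ m x, 0 ≤ p m x) (m : 𝓜) (y : Fin n → 𝒴) :
    outMass W p m y ≤ inMass p m :=
  Finset.sum_le_sum fun x _ => mul_le_of_le_one_right (hp m x) (W.pn_le_one x y)

lemma inMass_pos_of_pos (hp : ∀ m x, 0 ≤ p m x) {m : 𝓜} {x : Fin n → 𝒳} (h : 0 < p m x) :
    0 < inMass p m :=
  h.trans_le (Finset.single_le_sum (f := p m) (fun x _ => hp m x) (Finset.mem_univ x))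

lemma inv_pow_mul_inMass_le_outMass {D : ℝ} (hD : 0 < D) (hW : ∀ x y, D⁻¹ ≤ W.w x y)
    (hp : ∀ m x, 0 ≤ p m x) (m : 𝓜) (y : Fin n → 𝒴) :
    D⁻¹ ^ n * inMass p m ≤ outMass W p m y := by
  rw [inMass, Finset.mul_sum]
  refine Finset.sum_le_sum fun x _ => ?_
  rw [mul_comm]
  exact mul_le_mul_of_nonneg_left (Channel.inv_pow_le_pn hD hW x y) (hp m x)

lemma spec_nonneg (hp : ∀ m x, 0 ≤ p m x) (m : 𝓜) (y : Fin n → 𝒴) : 0 ≤ spec W p m y := by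
  rw [spec, neg_nonneg]
  exact Real.logb_nonpos one_lt_two
    (div_nonneg (outMass_nonneg hp m y) (inMass_nonneg hp m))
    (div_le_one_of_le₀ (outMass_le_inMass hp m y) (inMass_nonneg hp m))

lemma spec_le {D : ℝ} (hD : 0 < D) (hW : ∀ x y, D⁻¹ ≤ W.w x y) (hp : ∀ m x, 0 ≤ p m x)
    {m : 𝓜} (hm : 0 < inMass p m) (y : Fin n → 𝒴) : spec W p m y ≤ n * Real.logb 2 D := by
  have h : Real.logb 2 (D⁻¹ ^ n) ≤ Real.logb 2 (outMass W p m y / inMass p m) := by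
    refine Real.logb_le_logb_of_le one_lt_two (by positivity) ?_
    rw [le_div_iff₀ hm]
    exact inv_pow_mul_inMass_le_outMass hD hW hp m y
  rw [Real.logb_pow, Real.logb_inv] at h
  rw [spec]
  linarith

lemma spec_boundedDiff {D : ℝ} (hD : 0 < D) (hW : ∀ x y, D⁻¹ ≤ W.w x y)
    (hp : ∀ m x, 0 ≤ p m x) {m : 𝓜} (hm : 0 < inMass p m) :
    BoundedDiff (Real.logb 2 D) (spec W p m) := by
  have hpos : ∀ y, 0 < outMass W p m y := fun y =>
    lt_of_lt_of_le (by positivity) (inv_pow_mul_inMass_le_outMass hD hW hp m y)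
  have key : ∀ y i c, outMass W p m (Function.update y i c) ≤ D * outMass W p m y := by
    intro y i c
    rw [outMass, outMass, Finset.mul_sum]
    refine Finset.sum_le_sum fun x _ => ?_
    rw [mul_left_comm]
    exact mul_le_mul_of_nonneg_left (Channel.pn_update_le hD hW x y i c) (hp m x)
  have key2 : ∀ y i c, spec W p m y - spec W p m (Function.update y i c) ≤ Real.logb 2 D := by
    intro y i c
    have h := Real.logb_le_logb_of_le one_lt_two (hpos _) (key y i c)
    rw [Real.logb_mul hD.ne' (hpos y).ne'] at h
    rw [spec, spec, Real.logb_div (hpos _).ne' hm.ne', Real.logb_div (hpos _).ne' hm.ne']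
    linarith
  intro y i c
  rw [abs_le]
  constructor
  · linarith [key2 y i c]
  · have := key2 (Function.update y i c) i (y i)
    rw [Function.update_idem, Function.update_eq_self] at this
    linarith

variable [Fintype 𝓜]

/-- `r ≤ p` is the part of the joint mass `p` of message and input that is cut out by an event of
probability `ρ` on which the mean output spectrum of the reference channel `W'` stays within a
window of width `Δ`; the channel `W` is close to `W'`. -/
structure IsLocalized (W W' : Channel 𝒳 𝒴) (p r : 𝓜 → (Fin n → 𝒳) → ℝ)
    (D η ρ κ Δ : ℝ) : Prop where
  one_lt_D : 1 < D
  inv_D_le : ∀ x y, D⁻¹ ≤ W'.w x y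
  η_lt_one : η < 1
  le_W' : ∀ x y, (1 - η) * W.w x y ≤ W'.w x y
  r_nonneg : ∀ m x, 0 ≤ r m x
  r_le : ∀ m x, r m x ≤ p m x
  sum_p_le : ∑ m, ∑ x, p m x ≤ 1
  sum_r : ∑ m, ∑ x, r m x = ρ
  ρ_pos : 0 < ρ
  window : ∀ m x, 0 < r m x → κ ≤ prodExp (fun i => W'.w (x i)) (spec W' p m) ∧
    prodExp (fun i => W'.w (x i)) (spec W' p m) ≤ κ + Δ

namespace IsLocalized

variable {D η ρ κ Δ : ℝ}

lemma p_nonneg (h : IsLocalized W W' p r D η ρ κ Δ) (m : 𝓜) (x : Fin n → 𝒳) : 0 ≤ p m x :=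
  (h.r_nonneg m x).trans (h.r_le m x)

lemma D_pos (h : IsLocalized W W' p r D η ρ κ Δ) : 0 < D := one_pos.trans h.one_lt_D

lemma ρ_le_one (h : IsLocalized W W' p r D η ρ κ Δ) : ρ ≤ 1 := by
  rw [← h.sum_r]
  exact (Finset.sum_le_sum fun m _ => Finset.sum_le_sum fun x _ => h.r_le m x).trans h.sum_p_le

lemma inMass_le (h : IsLocalized W W' p r D η ρ κ Δ) (m : 𝓜) :
    inMass r m ≤ 1 * inMass p m := by
  rw [one_mul]
  exact Finset.sum_le_sum fun x _ => h.r_le m x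

lemma outMass_le (h : IsLocalized W W' p r D η ρ κ Δ) (m : 𝓜) (y : Fin n → 𝒴) :
    outMass W r m y ≤ ((1 - η) ^ n)⁻¹ * outMass W' p m y := by
  have hη : 0 < 1 - η := sub_pos.2 h.η_lt_one
  rw [inv_mul_eq_div, le_div_iff₀ (by positivity), outMass, outMass, Finset.sum_mul]
  refine Finset.sum_le_sum fun x _ => ?_
  calc r m x * W.pn n x y * (1 - η) ^ n = r m x * ((1 - η) ^ n * W.pn n x y) := by ring
    _ ≤ p m x * W'.pn n x y := mul_le_mul (h.r_le m x)
        (Channel.pow_mul_pn_le hη.le h.le_W' x y)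
        (mul_nonneg (by positivity) (W.pn_nonneg x y)) (h.p_nonneg m x)

lemma sum_inMass (h : IsLocalized W W' p r D η ρ κ Δ) : ∑ m, inMass r m = ρ := h.sum_r

lemma sum_outMass_prod (W : Channel 𝒳 𝒴) (p : 𝓜 → (Fin n → 𝒳) → ℝ) :
    ∑ i : 𝓜 × (Fin n → 𝒴), outMass W p i.1 i.2 = ∑ m, inMass p m := by
  rw [Fintype.sum_prod_type]
  exact Finset.sum_congr rfl fun m _ => sum_outMass m

lemma logb_K (h : IsLocalized W W' p r D η ρ κ Δ) :
    Real.logb 2 (((1 - η) ^ n)⁻¹ / ρ) = -(n * Real.logb 2 (1 - η)) - Real.logb 2 ρ := by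
  have hη : 0 < 1 - η := sub_pos.2 h.η_lt_one
  rw [Real.logb_div (by positivity) h.ρ_pos.ne', Real.logb_inv, Real.logb_pow]

lemma spec_eq (h : IsLocalized W W' p r D η ρ κ Δ) {m : 𝓜} {y : Fin n → 𝒴}
    (hb : 0 < outMass W r m y) :
    spec W r m y = spec W' p m y + Real.logb 2 (outMass W' p m y * ρ / outMass W r m y)
      - Real.logb 2 (inMass p m * ρ / inMass r m) := by
  have hη : 0 < 1 - η := sub_pos.2 h.η_lt_one
  have h1 : 0 < outMass W' p m y :=
    pos_of_mul_pos_right (hb.trans_le (h.outMass_le m y)) (by positivity)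
  have h2 : 0 < inMass r m := hb.trans_le (outMass_le_inMass h.r_nonneg m y)
  have h3 : 0 < inMass p m := by have := h.inMass_le m; linarith
  have hρ := h.ρ_pos.ne'
  rw [spec, spec, Real.logb_div hb.ne' h2.ne', Real.logb_div h1.ne' h3.ne',
    Real.logb_div (mul_ne_zero h1.ne' hρ) hb.ne', Real.logb_div (mul_ne_zero h3.ne' hρ) h2.ne',
    Real.logb_mul h1.ne' hρ, Real.logb_mul h3.ne' hρ]
  ring

lemma abs_prodExp_spec_sub_le (h : IsLocalized W W' p r D η ρ κ Δ) {m : 𝓜} {x : Fin n → 𝒳}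
    (hr : 0 < r m x) :
    |prodExp (fun i => W.w (x i)) (spec W' p m) - prodExp (fun i => W'.w (x i)) (spec W' p m)| ≤
      n * Real.logb 2 D * η :=
  abs_prodExp_sub_le (W.isWeights x) (W'.isWeights x) (fun i b => h.le_W' (x i) b)
    (spec_boundedDiff h.D_pos h.inv_D_le h.p_nonneg
      (inMass_pos_of_pos h.p_nonneg (hr.trans_le (h.r_le m x))))

/-- Mean of the conditional output spectrum on the localizing event. -/
def meanSpec (W : Channel 𝒳 𝒴) (r : 𝓜 → (Fin n → 𝒳) → ℝ) (ρ : ℝ) : ℝ :=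
  (∑ m, ∑ y, outMass W r m y * spec W r m y) / ρ

lemma sum_outMass_mul_spec_eq (h : IsLocalized W W' p r D η ρ κ Δ) :
    ∑ m, ∑ y, outMass W r m y * spec W r m y =
      ∑ m, ∑ x, r m x * prodExp (fun i => W.w (x i)) (spec W' p m) +
      ∑ i : 𝓜 × (Fin n → 𝒴), outMass W r i.1 i.2 *
        Real.logb 2 (outMass W' p i.1 i.2 * ρ / outMass W r i.1 i.2) -
      ∑ m, inMass r m * Real.logb 2 (inMass p m * ρ / inMass r m) := by
  rw [Fintype.sum_prod_type, ← Finset.sum_add_distrib, ← Finset.sum_sub_distrib]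
  refine Finset.sum_congr rfl fun m _ => ?_
  rw [← sum_outMass_mul, ← sum_outMass (W := W) (p := r), Finset.sum_mul,
    ← Finset.sum_add_distrib, ← Finset.sum_sub_distrib]
  refine Finset.sum_congr rfl fun y _ => ?_
  rcases (outMass_nonneg (W := W) h.r_nonneg m y).lt_or_eq with hb | hb
  · rw [h.spec_eq hb, sum_outMass]
    ring
  · simp [← hb]

lemma meanSpec_bounds (h : IsLocalized W W' p r D η ρ κ Δ) :
    κ - n * Real.logb 2 D * η + n * Real.logb 2 (1 - η) + Real.logb 2 ρ ≤ meanSpec W r ρ ∧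
      meanSpec W r ρ ≤ κ + Δ + n * Real.logb 2 D * η - Real.logb 2 ρ := by
  have hη : 0 < 1 - η := sub_pos.2 h.η_lt_one
  have hρ := h.ρ_pos
  have e1 := sum_mul_llr_nonpos (K := ((1 - η) ^ n)⁻¹) (ρ := ρ)
    (b := fun i : 𝓜 × (Fin n → 𝒴) => outMass W r i.1 i.2)
    (q := fun i => outMass W' p i.1 i.2) (by positivity)
    (fun i => outMass_nonneg h.r_nonneg _ _) (fun i => h.outMass_le _ _)
    (fun i => outMass_nonneg h.p_nonneg _ _) ((sum_outMass_prod W' p).trans_le h.sum_p_le)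
    ((sum_outMass_prod W r).trans h.sum_inMass) hρ
  have e2 := le_sum_mul_llr (K := ((1 - η) ^ n)⁻¹) (ρ := ρ)
    (b := fun i : 𝓜 × (Fin n → 𝒴) => outMass W r i.1 i.2)
    (q := fun i => outMass W' p i.1 i.2) (by positivity)
    (fun i => outMass_nonneg h.r_nonneg _ _) (fun i => h.outMass_le _ _)
    ((sum_outMass_prod W r).trans h.sum_inMass) hρ
  have e3 := sum_mul_llr_nonpos (ρ := ρ) one_pos (fun m => inMass_nonneg h.r_nonneg m)
    h.inMass_le (fun m => inMass_nonneg h.p_nonneg m) h.sum_p_le h.sum_inMass hρ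
  have e4 := le_sum_mul_llr (ρ := ρ) one_pos (fun m => inMass_nonneg h.r_nonneg m)
    h.inMass_le h.sum_inMass hρ
  rw [h.logb_K] at e2
  rw [Real.logb_div one_ne_zero hρ.ne', Real.logb_one] at e4
  have e5 : ∑ m, ∑ x, r m x * prodExp (fun i => W.w (x i)) (spec W' p m) ≤
      ρ * (κ + Δ + n * Real.logb 2 D * η) := by
    rw [← h.sum_r, Finset.sum_mul]
    refine Finset.sum_le_sum fun m _ => ?_
    rw [Finset.sum_mul]
    refine Finset.sum_le_sum fun x _ => ?_
    rcases (h.r_nonneg m x).lt_or_eq with hr | hr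
    · have := (abs_le.1 (h.abs_prodExp_spec_sub_le hr)).2
      have := (h.window m x hr).2
      exact mul_le_mul_of_nonneg_left (by linarith) hr.le
    · simp [← hr]
  have e6 : ρ * (κ - n * Real.logb 2 D * η) ≤
      ∑ m, ∑ x, r m x * prodExp (fun i => W.w (x i)) (spec W' p m) := by
    rw [← h.sum_r, Finset.sum_mul]
    refine Finset.sum_le_sum fun m _ => ?_
    rw [Finset.sum_mul]
    refine Finset.sum_le_sum fun x _ => ?_
    rcases (h.r_nonneg m x).lt_or_eq with hr | hr
    · have := (abs_le.1 (h.abs_prodExp_spec_sub_le hr)).1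
      have := (h.window m x hr).1
      exact mul_le_mul_of_nonneg_left (by linarith) hr.le
    · simp [← hr]
  rw [meanSpec, h.sum_outMass_mul_spec_eq]
  constructor
  · rw [le_div_iff₀ hρ]
    linarith
  · rw [div_le_iff₀ hρ]
    linarith

lemma sum_spec_tail_le (h : IsLocalized W W' p r D η ρ κ Δ) {ε : ℝ} (hε : 0 ≤ ε) :
    ∑ m, ∑ y, (if spec W' p m y < κ - n * Real.logb 2 D * η - 2 * n * Real.logb 2 D * √ε ∨
        κ + Δ + n * Real.logb 2 D * η + 2 * n * Real.logb 2 D * √ε < spec W' p m y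
      then outMass W r m y else 0) ≤ 2 * 2 ^ (-(n * ε)) * ρ := by
  have hL : 0 < Real.logb 2 D := Real.logb_pos one_lt_two h.one_lt_D
  rw [← h.sum_r, Finset.mul_sum]
  refine Finset.sum_le_sum fun m _ => ?_
  have h1 := sum_outMass_mul (W := W) (p := r) (fun y => if spec W' p m y <
    κ - n * Real.logb 2 D * η - 2 * n * Real.logb 2 D * √ε ∨
        κ + Δ + n * Real.logb 2 D * η + 2 * n * Real.logb 2 D * √ε < spec W' p m y
      then (1 : ℝ) else 0) m
  simp only [mul_ite, mul_one, mul_zero] at h1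
  rw [h1, Finset.mul_sum]
  refine Finset.sum_le_sum fun x _ => ?_
  rcases (h.r_nonneg m x).lt_or_eq with hr | hr
  · rw [mul_comm (2 * 2 ^ (-(n * ε)) : ℝ)]
    refine mul_le_mul_of_nonneg_left ?_ hr.le
    refine le_trans (prodExp_mono (W.isWeights x) fun y => ?_)
      (prodExp_two_sided_tail hL (W.isWeights x) (spec_boundedDiff h.D_pos h.inv_D_le h.p_nonneg
      (inMass_pos_of_pos h.p_nonneg (hr.trans_le (h.r_le m x)))) hε)
    obtain ⟨h2, h3⟩ := abs_le.1 (h.abs_prodExp_spec_sub_le hr)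
    obtain ⟨h4, h5⟩ := h.window m x hr
    split_ifs with h6 h7
    · exact le_rfl
    · exfalso
      apply h7
      rw [lt_abs]
      rcases h6 with h6 | h6
      · right; linarith
      · left; linarith
    · exact zero_le_one
    · exact le_rfl
  · simp [← hr]

lemma sum_atypical_le (h : IsLocalized W W' p r D η ρ κ Δ) {ε R : ℝ} (hε : 0 ≤ ε) (hη0 : 0 ≤ η)
    (hR : Δ + 2 * (n * Real.logb 2 D * η) + 2 * n * Real.logb 2 D * √ε + n * ε -
      2 * Real.logb 2 ρ - n * Real.logb 2 (1 - η) ≤ R) :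
    ∑ m, ∑ y, (if 0 < outMass W r m y ∧ ¬ (|spec W r m y - meanSpec W r ρ| ≤ R ∧
        |Real.logb 2 (inMass p m * ρ / inMass r m)| ≤ n * ε - Real.logb 2 ρ)
      then outMass W r m y else 0) ≤ 4 * 2 ^ (-(n * ε)) * ρ := by
  have hη : 0 < 1 - η := sub_pos.2 h.η_lt_one
  have hρ := h.ρ_pos
  have hρ1 : Real.logb 2 ρ ≤ 0 := Real.logb_nonpos one_lt_two hρ.le h.ρ_le_one
  have hη1 : n * Real.logb 2 (1 - η) ≤ 0 := mul_nonpos_of_nonneg_of_nonpos (by positivity)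
    (Real.logb_nonpos one_lt_two hη.le (by linarith))
  have hnε : 0 ≤ n * ε := by positivity
  have t1 := sum_llr_gt_le (K := ((1 - η) ^ n)⁻¹) (ρ := ρ)
    (b := fun i : 𝓜 × (Fin n → 𝒴) => outMass W r i.1 i.2)
    (q := fun i => outMass W' p i.1 i.2) (by positivity) hρ (fun i => h.outMass_le _ _)
    (fun i => outMass_nonneg h.p_nonneg _ _) ((sum_outMass_prod W' p).trans_le h.sum_p_le)
    (n * ε)
  have t2 := sum_llr_gt_le (ρ := ρ) one_pos hρ h.inMass_le
    (fun m => inMass_nonneg h.p_nonneg m) h.sum_p_le (n * ε)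
  have t3 := h.sum_spec_tail_le hε
  rw [Fintype.sum_prod_type] at t1
  have t2' : ∑ m, ∑ y, (if n * ε < Real.logb 2 (inMass p m * ρ / inMass r m)
      then outMass W r m y else 0) ≤ 2 ^ (-(n * ε)) * ρ := by
    refine le_trans (Finset.sum_le_sum fun m _ => ?_) t2
    by_cases hm : 0 < inMass r m
    · by_cases hc : n * ε < Real.logb 2 (inMass p m * ρ / inMass r m)
      · simp [hm, hc, sum_outMass]
      · simp [hc]
    · have h0 : inMass r m = 0 := le_antisymm (not_lt.1 hm) (inMass_nonneg h.r_nonneg m)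
      simp [h0, sum_outMass]
  have : (4 : ℝ) * 2 ^ (-(n * ε)) * ρ = 2 * 2 ^ (-(n * ε)) * ρ + 2 ^ (-(n * ε)) * ρ +
    2 ^ (-(n * ε)) * ρ := by ring
  rw [this]
  refine le_trans ?_ (add_le_add (add_le_add t3 t1) t2')
  rw [← Finset.sum_add_distrib, ← Finset.sum_add_distrib]
  refine Finset.sum_le_sum fun m _ => ?_
  rw [← Finset.sum_add_distrib, ← Finset.sum_add_distrib]
  refine Finset.sum_le_sum fun y _ => ?_
  have hb0 := outMass_nonneg (W := W) h.r_nonneg m y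
  by_cases hbad : 0 < outMass W r m y ∧ ¬ (|spec W r m y - meanSpec W r ρ| ≤ R ∧
        |Real.logb 2 (inMass p m * ρ / inMass r m)| ≤ n * ε - Real.logb 2 ρ)
  · rw [if_pos hbad]
    obtain ⟨hb, hbad⟩ := hbad
    by_contra hlt
    have c1 : ¬ (spec W' p m y < κ - n * Real.logb 2 D * η - 2 * n * Real.logb 2 D * √ε ∨
        κ + Δ + n * Real.logb 2 D * η + 2 * n * Real.logb 2 D * √ε < spec W' p m y) := by
      intro hc
      apply hlt
      rw [if_pos hc]
      split_ifs <;> linarith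
    have c2 : ¬ n * ε < Real.logb 2 (outMass W' p m y * ρ / outMass W r m y) := by
      intro hc
      apply hlt
      rw [if_pos (show 0 < outMass W r m y ∧ _ from ⟨hb, hc⟩)]
      split_ifs <;> linarith
    have c3 : ¬ n * ε < Real.logb 2 (inMass p m * ρ / inMass r m) := by
      intro hc
      apply hlt
      rw [if_pos hc]
      split_ifs <;> linarith
    have hm : 0 < inMass r m := hb.trans_le (outMass_le_inMass h.r_nonneg m y)
    have c4 := neg_logb_div_le_llr (b := fun i : 𝓜 × (Fin n → 𝒴) => outMass W r i.1 i.2)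
      (q := fun i => outMass W' p i.1 i.2) (i := (m, y)) (K := ((1 - η) ^ n)⁻¹)
      (by positivity) hρ hb (h.outMass_le m y)
    rw [h.logb_K] at c4
    have c5 := neg_logb_div_le_llr one_pos hρ hm (h.inMass_le m)
    rw [Real.logb_div one_ne_zero hρ.ne', Real.logb_one] at c5
    simp only [not_or, not_lt] at c1 c2 c3 c4
    obtain ⟨m1, m2⟩ := h.meanSpec_bounds
    apply hbad
    rw [h.spec_eq hb, abs_le, abs_le]
    refine ⟨⟨?_, ?_⟩, ?_, ?_⟩ <;> linarith
  · rw [if_neg hbad]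
    refine add_nonneg (add_nonneg ?_ ?_) ?_ <;> split_ifs <;> linarith

/-- Entropy of the message on the localizing event. -/
def msgEntropy (r : 𝓜 → (Fin n → 𝒳) → ℝ) (ρ : ℝ) : ℝ :=
  -∑ m, inMass r m / ρ * Real.logb 2 (inMass r m / ρ)

lemma neg_logb_inMass_div (h : IsLocalized W W' p r D η ρ κ Δ) {m : 𝓜} (hm : 0 < inMass r m) :
    -Real.logb 2 (inMass r m / ρ) =
      -Real.logb 2 (inMass p m) + Real.logb 2 (inMass p m * ρ / inMass r m) := by
  have h3 : 0 < inMass p m := by have := h.inMass_le m; linarith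
  have hρ := h.ρ_pos.ne'
  rw [Real.logb_div hm.ne' hρ, Real.logb_div (mul_ne_zero h3.ne' hρ) hm.ne',
    Real.logb_mul h3.ne' hρ]
  ring

lemma msgEntropy_bounds (h : IsLocalized W W' p r D η ρ κ Δ) {k δ : ℝ}
    (hk : ∀ m, 0 < inMass r m →
      k ≤ -Real.logb 2 (inMass p m) ∧ -Real.logb 2 (inMass p m) ≤ k + δ) :
    k + Real.logb 2 ρ ≤ msgEntropy r ρ ∧ msgEntropy r ρ ≤ k + δ := by
  have hρ := h.ρ_pos
  have e3 := sum_mul_llr_nonpos (ρ := ρ) one_pos (fun m => inMass_nonneg h.r_nonneg m)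
    h.inMass_le (fun m => inMass_nonneg h.p_nonneg m) h.sum_p_le h.sum_inMass hρ
  have e4 := le_sum_mul_llr (ρ := ρ) one_pos (fun m => inMass_nonneg h.r_nonneg m)
    h.inMass_le h.sum_inMass hρ
  rw [Real.logb_div one_ne_zero hρ.ne', Real.logb_one] at e4
  have e : msgEntropy r ρ = (∑ m, inMass r m * -Real.logb 2 (inMass p m) +
      ∑ m, inMass r m * Real.logb 2 (inMass p m * ρ / inMass r m)) / ρ := by
    rw [msgEntropy, ← Finset.sum_neg_distrib, ← Finset.sum_add_distrib, Finset.sum_div]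
    refine Finset.sum_congr rfl fun m _ => ?_
    rcases (inMass_nonneg h.r_nonneg m).lt_or_eq with hm | hm
    · rw [← mul_neg, h.neg_logb_inMass_div hm]
      ring
    · simp [← hm]
  have e5 : ∑ m, inMass r m * -Real.logb 2 (inMass p m) ≤ ρ * (k + δ) := by
    rw [← h.sum_inMass, Finset.sum_mul]
    refine Finset.sum_le_sum fun m _ => ?_
    rcases (inMass_nonneg h.r_nonneg m).lt_or_eq with hm | hm
    · exact mul_le_mul_of_nonneg_left (hk m hm).2 hm.le
    · simp [← hm]
  have e6 : ρ * k ≤ ∑ m, inMass r m * -Real.logb 2 (inMass p m) := by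
    rw [← h.sum_inMass, Finset.sum_mul]
    refine Finset.sum_le_sum fun m _ => ?_
    rcases (inMass_nonneg h.r_nonneg m).lt_or_eq with hm | hm
    · exact mul_le_mul_of_nonneg_left (hk m hm).1 hm.le
    · simp [← hm]
  rw [e]
  constructor
  · rw [le_div_iff₀ hρ]
    linarith
  · rw [div_le_iff₀ hρ]
    linarith

end IsLocalized

end Spectrum

section ChannelNet

variable {𝒳 𝒴 : Type*} [Fintype 𝒴] [Nonempty 𝒴] {N : ℕ}

/-- The channel whose transition probabilities are proportional to `a x y + 1`. -/
def gridChannel (a : 𝒳 → 𝒴 → Fin (N + 1)) : Channel 𝒳 𝒴 where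
  w x y := ((a x y : ℝ) + 1) / ∑ b, ((a x b : ℝ) + 1)
  nonneg x y := by positivity
  sum_one x := by
    rw [← Finset.sum_div]
    refine div_self (ne_of_gt (Finset.sum_pos (fun b _ => by positivity) Finset.univ_nonempty))

lemma exists_gridChannel_near (hN : 0 < N) (W : Channel 𝒳 𝒴) :
    ∃ a : 𝒳 → 𝒴 → Fin (N + 1),
      (∀ x y, ((N : ℝ) + Fintype.card 𝒴)⁻¹ ≤ (gridChannel a).w x y) ∧
      ∀ x y, (1 - (Fintype.card 𝒴 : ℝ) / (N + Fintype.card 𝒴)) * W.w x y ≤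
        (gridChannel a).w x y := by
  have hN' : (0 : ℝ) < N := by exact_mod_cast hN
  have hfl : ∀ x y, (⌊N * W.w x y⌋₊ : ℝ) ≤ N * W.w x y := fun x y =>
    Nat.floor_le (mul_nonneg hN'.le (W.nonneg x y))
  refine ⟨fun x y => ⟨⌊N * W.w x y⌋₊, ?_⟩, ?_⟩
  · have : (⌊N * W.w x y⌋₊ : ℝ) ≤ N :=
      (hfl x y).trans (mul_le_of_le_one_right hN'.le (W.w_le_one x y))
    exact Nat.lt_succ_of_le (by exact_mod_cast this)
  · have hs : ∀ x, ∑ b, ((⌊N * W.w x b⌋₊ : ℝ) + 1) ≤ N + Fintype.card 𝒴 := by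
      intro x
      calc _ ≤ ∑ b, (N * W.w x b + 1) := Finset.sum_le_sum fun b _ => by linarith [hfl x b]
        _ = _ := by simp [Finset.sum_add_distrib, ← Finset.mul_sum, W.sum_one]
    have hs0 : ∀ x, 0 < ∑ b, ((⌊N * W.w x b⌋₊ : ℝ) + 1) := fun x =>
      Finset.sum_pos (fun b _ => by positivity) Finset.univ_nonempty
    constructor
    · intro x y
      simp only [gridChannel]
      rw [inv_eq_one_div]
      exact div_le_div₀ (by positivity) (by simp) (hs0 x) (hs x)
    · intro x y
      simp only [gridChannel]
      have h1 : (1 - (Fintype.card 𝒴 : ℝ) / (N + Fintype.card 𝒴)) * W.w x y =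
          N * W.w x y / (N + Fintype.card 𝒴) := by
        field_simp
        ring
      rw [h1]
      exact div_le_div₀ (by positivity) (Nat.lt_floor_add_one _).le (hs0 x) (hs x)

end ChannelNet

section Binning

/-- Index of the interval of width `δ` that contains `t`, truncated at `K`. -/
def binIndex (K : ℕ) (δ t : ℝ) : Fin (K + 1) := ⟨min ⌊t / δ⌋₊ K, by omega⟩

lemma binIndex_window {K : ℕ} {δ t : ℝ} (hδ : 0 < δ) (ht : 0 ≤ t) (h : t < (K + 1) * δ) :
    (binIndex K δ t : ℝ) * δ ≤ t ∧ t ≤ (binIndex K δ t : ℝ) * δ + δ := by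
  have h0 : 0 ≤ t / δ := by positivity
  have h1 : ⌊t / δ⌋₊ ≤ K := by
    rw [← Nat.lt_succ_iff, Nat.floor_lt h0]
    push_cast
    rwa [div_lt_iff₀ hδ]
  have h2 : ((binIndex K δ t : ℕ) : ℝ) = (⌊t / δ⌋₊ : ℝ) := by simp [binIndex, h1]
  have h3 := Nat.floor_le h0
  have h4 := (Nat.lt_floor_add_one (t / δ)).le
  rw [le_div_iff₀ hδ] at h3
  rw [div_le_iff₀ hδ] at h4
  rw [h2]
  exact ⟨h3, by linarith⟩

lemma binIndex_one_of_lt {K : ℕ} {t : ℝ} (ht : 0 ≤ t) (h : (binIndex K 1 t : ℕ) < K) :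
    (binIndex K 1 t : ℝ) ≤ t ∧ t ≤ (binIndex K 1 t : ℝ) + 1 := by
  have h1 : ⌊t⌋₊ < K := by
    simp only [binIndex, div_one] at h
    omega
  have h2 := (Nat.floor_lt ht).1 h1
  simpa using binIndex_window (K := K) one_pos ht (by linarith)

lemma binIndex_one_of_ge {K : ℕ} {t : ℝ} (ht : 0 ≤ t) (h : ¬ (binIndex K 1 t : ℕ) < K) :
    (K : ℝ) ≤ t := by
  have h1 : K ≤ ⌊t⌋₊ := by
    simp only [binIndex, div_one] at h
    omega
  exact (Nat.le_floor_iff ht).1 h1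

end Binning

section Constants

lemma neg_logb_one_sub_le {N k : ℝ} (hN : 0 < N) (hk : 0 ≤ k) :
    -Real.logb 2 (1 - k / (N + k)) ≤ 2 * (k / N) := by
  have h1 : 1 - k / (N + k) = (1 + k / N)⁻¹ := by
    field_simp
    ring
  have h2 : 0 ≤ k / N := by positivity
  rw [h1, Real.logb_inv, neg_neg, Real.logb, div_le_iff₀ (Real.log_pos one_lt_two)]
  have := Real.log_le_sub_one_of_pos (show 0 < 1 + k / N by positivity)
  nlinarith [Real.log_two_gt_d9]

/-- Number of bits needed to label the bins of one message. -/
def labelBits (c N n : ℕ) : ℝ :=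
  ((N : ℝ) + 1) ^ c * Real.logb 2 (N + 1) + Real.logb 2 ((n : ℝ) ^ 2 + 1)

set_option maxHeartbeats 1000000 in
lemma exists_constant (c k : ℕ) :
    ∃ C : ℝ, 1 ≤ C ∧ ∀ n : ℕ, 27 ≤ n → ∀ ε : ℝ, ε = (n : ℝ) ^ (-(1 : ℝ) / ((c : ℝ) + 1)) →
      0 < ε ∧ ∃ N : ℕ, 0 < N ∧ 1 ≤ N * √ε ∧
        ∀ l : ℕ, 0 < l → ∀ τ : ℝ, 0 ≤ τ →
          τ + l * labelBits c N n ≤ C * (τ + l * n * ε * -Real.logb 2 ε) ∧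
          0 < C * (1 / n * τ + l * √ε * -Real.logb 2 ε) ∧
          n * Real.logb 2 (N + k) * √ε + 2 * (n * Real.logb 2 (N + k) * (k / (N + k))) +
            2 * n * Real.logb 2 (N + k) * √ε + n * ε +
            2 * (τ + l * labelBits c N n + n * ε) - n * Real.logb 2 (1 - k / (N + k)) + 1 ≤
            n * (C * (1 / n * τ + l * √ε * -Real.logb 2 ε)) := by
  set A : ℝ := (c : ℝ) + 1 with hA
  have hA1 : 1 ≤ A := by simp [hA]
  set B : ℝ := 1 + Real.logb 2 (k + 2) * A with hB
  set B3 : ℝ := 1 + Real.logb 2 3 * A with hB3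
  have hlk : 0 ≤ Real.logb 2 ((k : ℝ) + 2) :=
    Real.logb_nonneg one_lt_two (by have : (0 : ℝ) ≤ k := k.cast_nonneg; linarith)
  have hl3 : 0 ≤ Real.logb 2 3 := Real.logb_nonneg one_lt_two (by norm_num)
  have hB0 : 0 ≤ B := by positivity
  have hB30 : 0 ≤ B3 := by positivity
  set A2 : ℝ := 3 ^ c * B3 + 3 * A with hA2
  have hA20 : 0 ≤ A2 := by positivity
  have hk0 : (0 : ℝ) ≤ k := k.cast_nonneg
  refine ⟨2 + 3 * B + 2 * k * B + 4 * A + 2 * A2 + 2 * k * A, ?_, ?_⟩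
  · have : 0 ≤ 3 * B + 2 * k * B + 4 * A + 2 * A2 + 2 * k * A := by positivity
    linarith
  set C : ℝ := 2 + 3 * B + 2 * k * B + 4 * A + 2 * A2 + 2 * k * A with hC
  intro n hn ε hε
  have hn27 : (27 : ℝ) ≤ n := by exact_mod_cast hn
  have hn0 : (0 : ℝ) < n := by linarith
  have hε0 : 0 < ε := hε ▸ Real.rpow_pos_of_pos hn0 _
  have hε1 : ε ≤ 1 := by
    rw [hε]
    exact Real.rpow_le_one_of_one_le_of_nonpos (by linarith)
      (div_nonpos_of_nonpos_of_nonneg (by norm_num) (by positivity))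
  refine ⟨hε0, ⌈1 / ε⌉₊, Nat.ceil_pos.2 (by positivity), ?_⟩
  set N : ℕ := ⌈1 / ε⌉₊ with hNdef
  have hNpos : (0 : ℝ) < N := by
    exact_mod_cast Nat.ceil_pos.2 (show 0 < 1 / ε by positivity)
  have hNlow : 1 ≤ N * ε := by
    have := Nat.le_ceil (1 / ε)
    rwa [div_le_iff₀ hε0] at this
  have hNup : N * ε ≤ 1 + ε := by
    have := (Nat.ceil_lt_add_one (show 0 ≤ 1 / ε by positivity)).le
    calc N * ε ≤ (1 / ε + 1) * ε := mul_le_mul_of_nonneg_right this hε0.le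
      _ = 1 + ε := by field_simp
  set ℓ : ℝ := -Real.logb 2 ε with hℓ
  have hlogn : Real.logb 2 n = A * ℓ := by
    rw [hℓ, hε, Real.logb_rpow_eq_mul_logb_of_pos hn0]
    field_simp
  have hAℓ : 1 ≤ A * ℓ := by
    rw [← hlogn, Real.le_logb_iff_rpow_le one_lt_two hn0]
    norm_num
    linarith
  have hℓ0 : 0 < ℓ := pos_of_mul_pos_right (by linarith) (by linarith : (0 : ℝ) ≤ A)
  have hpow : ε ^ c * (n * ε) = 1 := by
    have h1 : ε ^ (c + 1) = (n : ℝ)⁻¹ := by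
      rw [hε, ← Real.rpow_natCast, ← Real.rpow_mul hn0.le, ← Real.rpow_neg_one]
      congr 1
      push_cast
      field_simp
      rw [hA]
    calc ε ^ c * (n * ε) = n * ε ^ (c + 1) := by ring
      _ = 1 := by rw [h1]; field_simp
  have hnε : 1 ≤ n * ε := by
    rw [← hpow]
    exact mul_le_of_le_one_left (by positivity) (pow_le_one₀ hε0.le hε1)
  have hsq : ε ≤ √ε := Real.le_sqrt_of_sq_le (by nlinarith)
  have hsq0 : 0 < √ε := Real.sqrt_pos.2 hε0
  refine ⟨hNlow.trans (mul_le_mul_of_nonneg_left hsq hNpos.le), ?_⟩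
  intro l hl τ hτ
  have hl1 : (1 : ℝ) ≤ l := by exact_mod_cast hl
  have hN1 : Real.logb 2 (N + 1) ≤ B3 * ℓ := by
    have h1 : Real.logb 2 (N + 1) ≤ Real.logb 2 (3 / ε) := by
      refine Real.logb_le_logb_of_le one_lt_two (by positivity) ?_
      rw [le_div_iff₀ hε0]
      linarith
    rw [Real.logb_div (by norm_num) hε0.ne'] at h1
    have : Real.logb 2 3 * 1 ≤ Real.logb 2 3 * (A * ℓ) := mul_le_mul_of_nonneg_left hAℓ hl3
    calc _ ≤ Real.logb 2 3 * 1 + ℓ := by rw [hℓ]; linarith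
      _ ≤ Real.logb 2 3 * (A * ℓ) + ℓ := by linarith
      _ = _ := by rw [hB3]; ring
  have hL : Real.logb 2 (N + k) ≤ B * ℓ := by
    have h1 : Real.logb 2 (N + k) ≤ Real.logb 2 ((k + 2) / ε) := by
      refine Real.logb_le_logb_of_le one_lt_two (by positivity) ?_
      rw [le_div_iff₀ hε0]
      nlinarith
    rw [Real.logb_div (by positivity) hε0.ne'] at h1
    have := mul_le_mul_of_nonneg_left hAℓ hlk
    calc _ ≤ Real.logb 2 (k + 2) * 1 + ℓ := by rw [hℓ]; linarith
      _ ≤ Real.logb 2 (k + 2) * (A * ℓ) + ℓ := by linarith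
      _ = _ := by rw [hB]; ring
  have hbits : labelBits c N n ≤ A2 * (n * ε * ℓ) := by
    have h1 : ((N : ℝ) + 1) ^ c ≤ 3 ^ c * (n * ε) := by
      calc ((N : ℝ) + 1) ^ c = (((N : ℝ) + 1) * ε) ^ c * (n * ε) := by
            rw [mul_pow, mul_assoc, hpow, mul_one]
        _ ≤ _ := by
            refine mul_le_mul_of_nonneg_right (pow_le_pow_left₀ (by positivity) ?_ _)
              (by positivity)
            linarith
    have h2 : Real.logb 2 ((n : ℝ) ^ 2 + 1) ≤ 3 * (A * ℓ) := by
      rw [← hlogn]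
      calc _ ≤ Real.logb 2 ((n : ℝ) ^ 3) :=
            Real.logb_le_logb_of_le one_lt_two (by positivity) (by nlinarith [sq_nonneg (n : ℝ)])
        _ = _ := by rw [Real.logb_pow]; norm_num
    have h3 : ((N : ℝ) + 1) ^ c * Real.logb 2 (N + 1) ≤ 3 ^ c * (n * ε) * (B3 * ℓ) :=
      mul_le_mul h1 hN1 (Real.logb_nonneg one_lt_two (by linarith)) (by positivity)
    have h4 : 3 * (A * ℓ) ≤ 3 * (A * ℓ) * (n * ε) := le_mul_of_one_le_right (by positivity) hnε
    calc _ ≤ 3 ^ c * (n * ε) * (B3 * ℓ) + 3 * (A * ℓ) * (n * ε) := by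
          rw [labelBits]; linarith
      _ = _ := by rw [hA2]; ring
  set S : ℝ := l * n * √ε * ℓ with hS
  have hS0 : 0 < S := by positivity
  have hS1 : n * √ε * ℓ ≤ S := by
    have := mul_le_mul_of_nonneg_right hl1 (show 0 ≤ n * √ε * ℓ by positivity)
    calc _ ≤ l * (n * √ε * ℓ) := by linarith
      _ = _ := by rw [hS]; ring
  have hS2 : n * ε * ℓ ≤ n * √ε * ℓ := by gcongr
  have hlbits : l * labelBits c N n ≤ A2 * (l * n * ε * ℓ) := by
    calc _ ≤ l * (A2 * (n * ε * ℓ)) := mul_le_mul_of_nonneg_left hbits (by linarith)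
      _ = _ := by ring
  have hlS : l * n * ε * ℓ ≤ S := by rw [hS]; gcongr
  have hlε0 : 0 ≤ l * n * ε * ℓ := by positivity
  have hAkB : 0 ≤ 3 * B + 2 * k * B + 4 * A + A2 + 2 * k * A := by positivity
  have hrest : 0 ≤ 3 * B + 2 * k * B + 4 * A + 2 * A2 + 2 * k * A := by positivity
  refine ⟨?_, ?_, ?_⟩
  · have h1 : A2 * (l * n * ε * ℓ) ≤ C * (l * n * ε * ℓ) :=
      mul_le_mul_of_nonneg_right (by rw [hC]; linarith) hlε0
    have h2 : 1 * τ ≤ C * τ := mul_le_mul_of_nonneg_right (by rw [hC]; linarith) hτ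
    linarith
  · have : 0 < C := by rw [hC]; linarith
    positivity
  · have hη : (k : ℝ) / (N + k) ≤ k * √ε := by
      rw [div_le_iff₀ (by positivity)]
      have h1 : 1 ≤ √ε * (N + k) := by
        have := mul_le_mul_of_nonneg_left hsq hNpos.le
        have : 0 ≤ √ε * k := by positivity
        nlinarith
      calc (k : ℝ) = k * 1 := by ring
        _ ≤ k * (√ε * (N + k)) := mul_le_mul_of_nonneg_left h1 hk0
        _ = _ := by ring
    have e1 : n * Real.logb 2 (N + k) * √ε ≤ B * S := by
      calc _ ≤ n * (B * ℓ) * √ε := by gcongr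
        _ = B * (n * √ε * ℓ) := by ring
        _ ≤ _ := mul_le_mul_of_nonneg_left hS1 hB0
    have hLn : 0 ≤ Real.logb 2 ((N : ℝ) + k) := by
      refine Real.logb_nonneg one_lt_two ?_
      have : (1 : ℝ) ≤ N := by exact_mod_cast Nat.ceil_pos.2 (show 0 < 1 / ε by positivity)
      linarith
    have e2 : n * Real.logb 2 (N + k) * (k / (N + k)) ≤ k * B * S := by
      calc _ ≤ n * Real.logb 2 (N + k) * (k * √ε) := mul_le_mul_of_nonneg_left hη (by positivity)
        _ = k * (n * Real.logb 2 (N + k) * √ε) := by ring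
        _ ≤ k * (B * S) := mul_le_mul_of_nonneg_left e1 hk0
        _ = _ := by ring
    have e3 : n * ε ≤ A * S := by
      calc n * ε ≤ n * ε * (A * ℓ) := le_mul_of_one_le_right (by positivity) hAℓ
        _ = A * (n * ε * ℓ) := by ring
        _ ≤ _ := mul_le_mul_of_nonneg_left (hS2.trans hS1) (by linarith)
    have e4 : -(n * Real.logb 2 (1 - k / (N + k))) ≤ 2 * k * A * S := by
      have h1 := neg_logb_one_sub_le hNpos hk0
      have h2 : (k : ℝ) / N ≤ k * ε := by
        rw [div_le_iff₀ hNpos]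
        calc (k : ℝ) = k * 1 := by ring
          _ ≤ k * (N * ε) := mul_le_mul_of_nonneg_left hNlow hk0
          _ = _ := by ring
      calc _ = n * -Real.logb 2 (1 - k / (N + k)) := by ring
        _ ≤ n * (2 * (k * ε)) := mul_le_mul_of_nonneg_left (by linarith) hn0.le
        _ = 2 * k * (n * ε) := by ring
        _ ≤ 2 * k * (A * S) := mul_le_mul_of_nonneg_left e3 (by positivity)
        _ = _ := by ring
    have e5 : l * labelBits c N n ≤ A2 * S := hlbits.trans (mul_le_mul_of_nonneg_left hlS hA20)
    have e6 : n * (C * (1 / n * τ + l * √ε * ℓ)) = C * τ + C * S := by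
      rw [hS]
      field_simp
    have e7 : 2 * τ ≤ C * τ := mul_le_mul_of_nonneg_right (by rw [hC]; linarith) hτ
    have e8 : C * S = 2 * S + 3 * (B * S) + 2 * (k * B * S) + 4 * (A * S) + 2 * (A2 * S) +
        2 * k * A * S := by rw [hC]; ring
    rw [e6]
    have : 2 * n * Real.logb 2 (N + k) * √ε = 2 * (n * Real.logb 2 (N + k) * √ε) := by ring
    linarith

end Constants

section Translation

variable {μ : PMF Ω} {𝓜 𝒳 𝒴 : Type*} {n : ℕ}

section

variable [Fintype 𝒴]

lemma IsOutput.pr_inter_eq {α : Type*} [Fintype α] {V : Ω → α} {X : Ω → Fin n → 𝒳}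
    {Y : Ω → Fin n → 𝒴} {W : Channel 𝒳 𝒴} (hout : IsOutput μ X Y W) (hM : Markov μ V X Y)
    (S : Set α) (x : Fin n → 𝒳) (y : Fin n → 𝒴) :
    pr μ ({ω | V ω ∈ S} ∩ {ω | X ω = x ∧ Y ω = y}) =
      pr μ ({ω | V ω ∈ S} ∩ {ω | X ω = x}) * W.pn n x y := by
  rw [pr_setOf_comp μ V _ (fun a => a ∈ S), pr_setOf_comp μ V _ (fun a => a ∈ S),
    Finset.sum_mul]
  refine Finset.sum_congr rfl fun a _ => ?_
  split_ifs with ha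
  · have e1 : {ω | X ω = x ∧ Y ω = y} ∩ {ω | V ω = a} =
        {ω | V ω = a ∧ X ω = x ∧ Y ω = y} := by
      ext ω
      simp only [Set.mem_inter_iff, Set.mem_ofPred_eq]
      tauto
    have e2 : {ω | X ω = x} ∩ {ω | V ω = a} = {ω | V ω = a ∧ X ω = x} := by
      ext ω
      simp only [Set.mem_inter_iff, Set.mem_ofPred_eq]
      tauto
    rw [e1, e2]
    rcases (pr_nonneg μ {ω | X ω = x}).lt_or_eq with hx | hx
    · have h1 := hM a x y
      have h2 := hout x y hx
      rw [cpr, div_eq_iff hx.ne'] at h2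
      have e3 : {ω | Y ω = y} ∩ {ω | X ω = x} = {ω | X ω = x ∧ Y ω = y} := by
        ext ω
        simp only [Set.mem_inter_iff, Set.mem_ofPred_eq]
        tauto
      rw [e3] at h2
      rw [h2] at h1
      refine mul_right_cancel₀ hx.ne' (h1.trans ?_)
      ring
    · have h1 : pr μ {ω | V ω = a ∧ X ω = x ∧ Y ω = y} = 0 :=
        le_antisymm (hx ▸ pr_mono μ fun ω h => h.2.1) (pr_nonneg μ _)
      have h2 : pr μ {ω | V ω = a ∧ X ω = x} = 0 :=
        le_antisymm (hx ▸ pr_mono μ fun ω h => h.2) (pr_nonneg μ _)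
      rw [h1, h2, zero_mul]
  · simp

lemma Markov.of_comp {α β : Type*} [Fintype α] {V : Ω → α} {X : Ω → Fin n → 𝒳}
    {Y : Ω → Fin n → 𝒴} {W : Channel 𝒳 𝒴} (hout : IsOutput μ X Y W) (hM : Markov μ V X Y)
    (f : α → (Fin n → 𝒳) → β) : Markov μ (fun ω => f (V ω) (X ω)) X Y := by
  intro b x y
  have e1 : {ω | f (V ω) (X ω) = b ∧ X ω = x ∧ Y ω = y} =
      {ω | V ω ∈ {a | f a x = b}} ∩ {ω | X ω = x ∧ Y ω = y} := by
    ext ω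
    simp only [Set.mem_inter_iff, Set.mem_ofPred_eq]
    constructor <;> rintro ⟨h, rfl, h'⟩ <;> exact ⟨h, rfl, h'⟩
  have e2 : {ω | f (V ω) (X ω) = b ∧ X ω = x} =
      {ω | V ω ∈ {a | f a x = b}} ∩ {ω | X ω = x} := by
    ext ω
    simp only [Set.mem_inter_iff, Set.mem_ofPred_eq]
    constructor <;> rintro ⟨h, rfl⟩ <;> exact ⟨h, rfl⟩
  have e3 := hout.pr_inter_eq hM Set.univ x y
  simp only [Set.mem_univ, Set.ofPred_true, Set.univ_inter] at e3
  rw [e1, e2, hout.pr_inter_eq hM, e3]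
  ring

end

/-- Joint mass of message and input on the event `E`. -/
def jointMass (μ : PMF Ω) (M : Ω → 𝓜) (X : Ω → Fin n → 𝒳) (E : Set Ω) (m : 𝓜)
    (x : Fin n → 𝒳) : ℝ := pr μ (({ω | M ω = m} ∩ E) ∩ {ω | X ω = x})

variable {M : Ω → 𝓜} {X : Ω → Fin n → 𝒳} {E : Set Ω}

lemma jointMass_nonneg (m : 𝓜) (x : Fin n → 𝒳) : 0 ≤ jointMass μ M X E m x := pr_nonneg μ _

lemma jointMass_le_univ (m : 𝓜) (x : Fin n → 𝒳) :
    jointMass μ M X E m x ≤ jointMass μ M X Set.univ m x :=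
  pr_mono μ fun _ h => ⟨⟨h.1.1, Set.mem_univ _⟩, h.2⟩

lemma exists_of_jointMass_pos {m : 𝓜} {x : Fin n → 𝒳} (h : 0 < jointMass μ M X E m x) :
    ∃ ω ∈ E, M ω = m ∧ X ω = x := by
  by_contra! hc
  have : ({ω | M ω = m} ∩ E) ∩ {ω | X ω = x} = ∅ := by
    ext ω
    simp only [Set.mem_inter_iff, Set.mem_ofPred_eq, Set.mem_empty_iff_false, iff_false]
    rintro ⟨⟨h1, h2⟩, h3⟩
    exact hc ω h2 h1 h3
  rw [jointMass, this] at h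
  simp [pr] at h

variable [Fintype 𝒴] {Y : Ω → Fin n → 𝒴} {W W' : Channel 𝒳 𝒴}

/-- On the event `E` the input still determines the law of the output of `W`. -/
def FactorsThrough (μ : PMF Ω) (M : Ω → 𝓜) (X : Ω → Fin n → 𝒳) (Y : Ω → Fin n → 𝒴)
    (E : Set Ω) (W : Channel 𝒳 𝒴) : Prop :=
  ∀ m x y, pr μ (({ω | M ω = m} ∩ E) ∩ {ω | X ω = x ∧ Y ω = y}) =
    jointMass μ M X E m x * W.pn n x y

lemma Markov.factorsThrough {ι α β : Type*} [Fintype ι] [Fintype α] {𝓝 : ι → Type*}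
    [∀ j, Fintype (𝓝 j)] {T : Ω → α} {M : ∀ j, Ω → 𝓝 j} {X : Ω → Fin n → 𝒳}
    {Y : Ω → Fin n → 𝒴} {W : Channel 𝒳 𝒴} (hout : IsOutput μ X Y W)
    (hM : Markov μ (fun ω => (T ω, fun j => M j ω)) X Y)
    (f : α × (∀ j, 𝓝 j) → (Fin n → 𝒳) → β) (u : β) (j : ι) :
    FactorsThrough μ (M j) X Y {ω | f (T ω, fun j => M j ω) (X ω) = u} W := by
  intro m x y
  have h := hout.pr_inter_eq hM {v | v.2 j = m ∧ f v x = u} x y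
  have e1 : ({ω | M j ω = m} ∩ {ω | f (T ω, fun j => M j ω) (X ω) = u}) ∩
      {ω | X ω = x ∧ Y ω = y} = {ω | (T ω, fun j => M j ω) ∈
        {v : α × (∀ j, 𝓝 j) | v.2 j = m ∧ f v x = u}} ∩ {ω | X ω = x ∧ Y ω = y} := by
    ext ω
    simp only [Set.mem_inter_iff, Set.mem_ofPred_eq]
    constructor <;> rintro ⟨h1, rfl, h2⟩ <;> exact ⟨h1, rfl, h2⟩
  have e2 : ({ω | M j ω = m} ∩ {ω | f (T ω, fun j => M j ω) (X ω) = u}) ∩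
      {ω | X ω = x} = {ω | (T ω, fun j => M j ω) ∈
        {v : α × (∀ j, 𝓝 j) | v.2 j = m ∧ f v x = u}} ∩ {ω | X ω = x} := by
    ext ω
    simp only [Set.mem_inter_iff, Set.mem_ofPred_eq]
    constructor <;> rintro ⟨h1, rfl⟩ <;> exact ⟨h1, rfl⟩
  rw [jointMass, e1, e2, h]

variable [Fintype 𝒳]

lemma inMass_jointMass (m : 𝓜) :
    inMass (jointMass μ M X E) m = pr μ ({ω | M ω = m} ∩ E) :=
  (pr_eq_sum_inter μ X _).symm

lemma FactorsThrough.outMass_eq (h : FactorsThrough μ M X Y E W) (m : 𝓜) (y : Fin n → 𝒴) :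
    outMass W (jointMass μ M X E) m y = pr μ ({ω | Y ω = y} ∩ ({ω | M ω = m} ∩ E)) := by
  rw [pr_eq_sum_inter μ X, outMass]
  refine Finset.sum_congr rfl fun x _ => ?_
  rw [← h]
  congr 1
  ext ω
  simp only [Set.mem_inter_iff, Set.mem_ofPred_eq]
  tauto

lemma FactorsThrough.spec_eq (h : FactorsThrough μ M X Y E W) (m : 𝓜) (y : Fin n → 𝒴) :
    spec W (jointMass μ M X E) m y =
      -Real.logb 2 (cpr μ {ω | Y ω = y} ({ω | M ω = m} ∩ E)) := by
  rw [spec, h.outMass_eq, inMass_jointMass, cpr]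

variable [Fintype 𝓜]

lemma sum_jointMass : ∑ m, ∑ x, jointMass μ M X E m x = pr μ E := by
  have : ∀ m, ∑ x, jointMass μ M X E m x = pr μ (E ∩ {ω | M ω = m}) := fun m => by
    rw [Set.inter_comm, ← inMass_jointMass (X := X), inMass]
  rw [pr_eq_sum_inter μ M E]
  exact Finset.sum_congr rfl fun m _ => this m

lemma msgEntropy_eq :
    IsLocalized.msgEntropy (jointMass μ M X E) (pr μ E) = HEvt μ M E := by
  rw [IsLocalized.msgEntropy, HEvt]
  simp only [inMass_jointMass, cpr]

lemma FactorsThrough.meanSpec_eq (h : FactorsThrough μ M X Y E W) :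
    IsLocalized.meanSpec W (jointMass μ M X E) (pr μ E) = HcEvt μ Y M E := by
  rw [IsLocalized.meanSpec, HcEvt, Finset.sum_comm, Finset.sum_div, ← Finset.sum_neg_distrib]
  refine Finset.sum_congr rfl fun y _ => ?_
  rw [Finset.sum_div, ← Finset.sum_neg_distrib]
  refine Finset.sum_congr rfl fun m _ => ?_
  rw [h.spec_eq, h.outMass_eq, ← Set.inter_assoc]
  simp only [cpr]
  ring

lemma IsLocalized.le_cpr {D η κ Δ ε R : ℝ}
    (h : IsLocalized W W' (jointMass μ M X Set.univ) (jointMass μ M X E) D η (pr μ E) κ Δ)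
    (hf : FactorsThrough μ M X Y E W) (hε : 0 ≤ ε) (hη0 : 0 ≤ η)
    (hR : Δ + 2 * (n * Real.logb 2 D * η) + 2 * n * Real.logb 2 D * √ε + n * ε -
      2 * Real.logb 2 (pr μ E) - n * Real.logb 2 (1 - η) ≤ R) {Q : 𝓜 → (Fin n → 𝒴) → Prop}
    (hQ : ∀ m y, 0 < inMass (jointMass μ M X E) m →
      |-Real.logb 2 (cpr μ {ω | Y ω = y} ({ω | M ω = m} ∩ E)) - HcEvt μ Y M E| ≤ R →
      |Real.logb 2 (inMass (jointMass μ M X Set.univ) m * pr μ E /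
        inMass (jointMass μ M X E) m)| ≤ n * ε - Real.logb 2 (pr μ E) → Q m y) :
    1 - 4 * 2 ^ (-(n * ε)) ≤ cpr μ {ω | Q (M ω) (Y ω)} E := by
  have hb := h.sum_atypical_le hε hη0 hR
  have hρ := h.ρ_pos
  have h1 : pr μ ({ω | Q (M ω) (Y ω)} ∩ E) =
      ∑ m, ∑ y, if Q m y then outMass W (jointMass μ M X E) m y else 0 := by
    rw [pr_setOf_comp μ (fun ω => (M ω, Y ω)) E (fun a => Q a.1 a.2), Fintype.sum_prod_type]
    refine Finset.sum_congr rfl fun m _ => Finset.sum_congr rfl fun y _ => ?_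
    rw [hf.outMass_eq]
    congr 2
    ext ω
    simp only [Set.mem_inter_iff, Set.mem_ofPred_eq, Prod.mk.injEq]
    tauto
  have h2 : pr μ E = ∑ m, ∑ y, outMass W (jointMass μ M X E) m y := by
    rw [← h.sum_inMass]
    exact Finset.sum_congr rfl fun m _ => (sum_outMass m).symm
  rw [cpr, le_div_iff₀ hρ, h1]
  have h3 : ∑ m, ∑ y, outMass W (jointMass μ M X E) m y ≤
      (∑ m, ∑ y, if Q m y then outMass W (jointMass μ M X E) m y else 0) +
        4 * 2 ^ (-(n * ε)) * pr μ E := by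
    refine le_trans ?_ (add_le_add le_rfl hb)
    rw [← Finset.sum_add_distrib]
    refine Finset.sum_le_sum fun m _ => ?_
    rw [← Finset.sum_add_distrib]
    refine Finset.sum_le_sum fun y _ => ?_
    have h0 := outMass_nonneg (W := W) h.r_nonneg m y
    by_cases hq : Q m y
    · rw [if_pos hq]
      split_ifs <;> linarith
    · rw [if_neg hq, zero_add]
      rcases h0.lt_or_eq with hpos | hzero
      · rw [if_pos]
        refine ⟨hpos, fun hg => hq (hQ m y ?_ ?_ hg.2)⟩
        · exact hpos.trans_le (outMass_le_inMass h.r_nonneg m y)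
        · rw [← hf.spec_eq, ← hf.meanSpec_eq]
          exact hg.1
      · rw [← hzero]
        split_ifs <;> exact le_rfl
  linarith

end Translation

section Support

variable {μ : PMF Ω} {α β : Type*} [Fintype α] [Fintype β]

lemma sum_pr_eq (U : Ω → α) : ∑ a, pr μ {ω | U ω = a} = 1 := by
  simpa [pr_univ] using (pr_eq_sum_inter μ U Set.univ).symm

lemma suppCard_pos (U : Ω → α) : 0 < suppCard μ U := by
  rw [suppCard, Finset.card_pos]
  by_contra hne
  rw [Finset.not_nonempty_iff_eq_empty, Finset.filter_eq_empty_iff] at hne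
  have h0 : ∑ a, pr μ {ω | U ω = a} ≤ 0 :=
    Finset.sum_nonpos fun a ha => not_lt.1 (hne ha)
  rw [sum_pr_eq] at h0
  linarith

lemma suppCard_prod_le (T : Ω → α) (B : Ω → β) :
    suppCard μ (fun ω => (T ω, B ω)) ≤ suppCard μ T * Fintype.card β := by
  rw [suppCard, suppCard, ← Finset.card_univ, ← Finset.card_product]
  refine Finset.card_le_card fun u hu => ?_
  simp only [Finset.mem_product, Finset.mem_filter, Finset.mem_univ, true_and, and_true] at hu ⊢
  refine hu.trans_le (pr_mono μ fun ω h => ?_)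
  have h' : (T ω, B ω) = u := h
  exact congrArg Prod.fst h'

lemma one_sub_le_pr_likely (U : Ω → α) {δ : ℝ} (hδ : 0 ≤ δ) :
    1 - δ ≤ pr μ {ω | U ω ∈ {u | δ / suppCard μ U ≤ pr μ {ω' | U ω' = u}}} := by
  have hS : (0 : ℝ) < suppCard μ U := by exact_mod_cast suppCard_pos U
  have h1 := pr_setOf_comp μ U Set.univ
    (fun u => u ∈ {u | δ / suppCard μ U ≤ pr μ {ω' | U ω' = u}})
  simp only [Set.inter_univ, Set.univ_inter] at h1
  rw [h1]
  have h2 : ∑ u, pr μ {ω | U ω = u} ≤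
      (∑ u, if u ∈ {u | δ / suppCard μ U ≤ pr μ {ω' | U ω' = u}} then pr μ {ω | U ω = u}
        else 0) + ∑ u, if 0 < pr μ {ω | U ω = u} then δ / suppCard μ U else 0 := by
    rw [← Finset.sum_add_distrib]
    refine Finset.sum_le_sum fun u _ => ?_
    have h0 := pr_nonneg μ {ω | U ω = u}
    have h3 : 0 ≤ δ / suppCard μ U := by positivity
    simp only [Set.mem_ofPred_eq]
    split_ifs <;> linarith
  rw [sum_pr_eq, ← Finset.sum_filter (p := fun u => 0 < pr μ {ω | U ω = u}),
    Finset.sum_const, nsmul_eq_mul] at h2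
  have h3 : ((Finset.univ.filter fun u => 0 < pr μ {ω | U ω = u}).card : ℝ) *
      (δ / suppCard μ U) = δ := mul_div_cancel₀ _ hS.ne'
  rw [h3] at h2
  linarith

end Support

section Stabilizer

variable {μ : PMF Ω} {𝓜 𝒳 𝒴 𝒰 : Type*} [Fintype 𝓜] [Fintype 𝒳] [Fintype 𝒴] {n : ℕ}
  {M : Ω → 𝓜} {X : Ω → Fin n → 𝒳} {U : Ω → 𝒰} {u : 𝒰} {Y : Channel 𝒳 𝒴 → Ω → Fin n → 𝒴}
  {D η Δ ε R : ℝ}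

/-- If conditioning on `U = u` localizes the input for every channel, then the spectra concentrate
up to `R`, whatever property `Q` of the message follows from the bound on its spectrum shift. -/
lemma le_cpr_spectrum
    (hloc : ∀ w : Channel 𝒳 𝒴, ∃ (W' : Channel 𝒳 𝒴) (κ : ℝ),
      IsLocalized w W' (jointMass μ M X Set.univ) (jointMass μ M X {ω | U ω = u}) D η (pr μ {ω | U ω = u}) κ Δ)
    (hf : ∀ w, FactorsThrough μ M X (Y w) {ω | U ω = u} w) (hΔ : 0 ≤ Δ) (hε : 0 ≤ ε)
    (hη0 : 0 ≤ η)
    (hR : Δ + 2 * (n * Real.logb 2 D * η) + 2 * n * Real.logb 2 D * √ε + n * ε -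
      2 * Real.logb 2 (pr μ {ω | U ω = u}) - n * Real.logb 2 (1 - η) + 1 ≤ R) {Q : 𝓜 → Prop}
    (hQ : ∀ (w W' : Channel 𝒳 𝒴) (κ : ℝ), IsLocalized w W' (jointMass μ M X Set.univ)
        (jointMass μ M X {ω | U ω = u}) D η (pr μ {ω | U ω = u}) κ Δ → ∀ m,
      0 < inMass (jointMass μ M X {ω | U ω = u}) m →
      hcs μ M U m u ≤ hs μ M m + R - 1 + Real.logb 2 (pr μ {ω | U ω = u}) →
      hs μ M m + Real.logb 2 (pr μ {ω | U ω = u}) ≤ hcs μ M U m u →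
      1 - 2 * Real.logb 2 (pr μ {ω | U ω = u}) ≤ R →
      0 ≤ -Real.logb 2 (pr μ {ω | U ω = u}) → Q m) (w : Channel 𝒳 𝒴) :
    1 - 8 * 2 ^ (-(n : ℝ) * ε) ≤
      cpr μ {ω | |(-Real.logb 2 (cpr μ {ω' | Y w ω' = Y w ω}
            ({ω' | M ω' = M ω} ∩ {ω' | U ω' = u}))) - HcEvt μ (Y w) M {ω' | U ω' = u}| ≤ R ∧
          Q (M ω) ∧ |hcs μ M U (M ω) u - hs μ M (M ω)| ≤ R} {ω | U ω = u} := by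
  obtain ⟨W', κ, h⟩ := hloc w
  have hη : 0 < 1 - η := sub_pos.2 h.η_lt_one
  have hL : 0 ≤ Real.logb 2 D := Real.logb_nonneg one_lt_two h.one_lt_D.le
  have hρ : 0 ≤ -Real.logb 2 (pr μ {ω | U ω = u}) :=
    neg_nonneg.2 (Real.logb_nonpos one_lt_two h.ρ_pos.le h.ρ_le_one)
  have hη' : 0 ≤ -(n * Real.logb 2 (1 - η)) := by
    rw [← mul_neg]
    exact mul_nonneg n.cast_nonneg
      (neg_nonneg.2 (Real.logb_nonpos one_lt_two hη.le (by linarith)))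
  have h1 : 0 ≤ n * Real.logb 2 D * η := by positivity
  have h2 : 0 ≤ 2 * n * Real.logb 2 D * √ε := by positivity
  have h3 : 0 ≤ n * ε := by positivity
  have key := h.le_cpr (hf w) hε hη0 (R := R) (by linarith) (Q := fun m y =>
    |(-Real.logb 2 (cpr μ {ω' | Y w ω' = y} ({ω' | M ω' = m} ∩ {ω' | U ω' = u}))) -
      HcEvt μ (Y w) M {ω' | U ω' = u}| ≤ R ∧ Q m ∧ |hcs μ M U m u - hs μ M m| ≤ R)
    (fun m y hm hy hd => by
      have hs_eq : hs μ M m = -Real.logb 2 (inMass (jointMass μ M X Set.univ) m) := by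
        rw [hs, inMass_jointMass, Set.inter_univ]
      have hcs_eq : hcs μ M U m u = hs μ M m +
          Real.logb 2 (inMass (jointMass μ M X Set.univ) m * pr μ {ω | U ω = u} /
            inMass (jointMass μ M X {ω | U ω = u}) m) := by
        rw [hs_eq, ← h.neg_logb_inMass_div hm, hcs, cpr, inMass_jointMass]
      have hlow := neg_logb_div_le_llr (q := inMass (jointMass μ M X Set.univ)) one_pos h.ρ_pos
        hm (h.inMass_le m)
      rw [Real.logb_div one_ne_zero h.ρ_pos.ne', Real.logb_one] at hlow
      have hup := (abs_le.1 hd).2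
      refine ⟨hy, hQ w W' κ h m hm (by linarith) (by linarith) (by linarith) hρ, ?_⟩
      rw [abs_le]
      constructor <;> linarith)
  refine le_trans ?_ key
  have : (0 : ℝ) < 2 ^ (-(n * ε)) := by positivity
  rw [neg_mul]
  linarith

lemma stable_or_saturated
    (hloc : ∀ w : Channel 𝒳 𝒴, ∃ (W' : Channel 𝒳 𝒴) (κ : ℝ),
      IsLocalized w W' (jointMass μ M X Set.univ) (jointMass μ M X {ω | U ω = u}) D η (pr μ {ω | U ω = u}) κ Δ)
    (hf : ∀ w, FactorsThrough μ M X (Y w) {ω | U ω = u} w) (hΔ : 0 ≤ Δ) (hε : 0 ≤ ε)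
    (hη0 : 0 ≤ η)
    (hR : Δ + 2 * (n * Real.logb 2 D * η) + 2 * n * Real.logb 2 D * √ε + n * ε -
      2 * Real.logb 2 (pr μ {ω | U ω = u}) - n * Real.logb 2 (1 - η) + 1 ≤ R)
    (b : Fin (n ^ 2 + 1))
    (hb : ∀ m, 0 < inMass (jointMass μ M X {ω | U ω = u}) m →
      binIndex (n ^ 2) 1 (hs μ M m) = b) :
    ((∀ w : Channel 𝒳 𝒴, 1 - 8 * 2 ^ (-(n : ℝ) * ε) ≤
      cpr μ {ω | |(-Real.logb 2 (cpr μ {ω' | Y w ω' = Y w ω}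
            ({ω' | M ω' = M ω} ∩ {ω' | U ω' = u}))) - HcEvt μ (Y w) M {ω' | U ω' = u}| ≤ R ∧
          |hcs μ M U (M ω) u - HEvt μ M {ω' | U ω' = u}| ≤ R ∧
          |hcs μ M U (M ω) u - hs μ M (M ω)| ≤ R} {ω | U ω = u}) ∨
    (∀ w : Channel 𝒳 𝒴, 1 - 8 * 2 ^ (-(n : ℝ) * ε) ≤
      cpr μ {ω | |(-Real.logb 2 (cpr μ {ω' | Y w ω' = Y w ω}
            ({ω' | M ω' = M ω} ∩ {ω' | U ω' = u}))) - HcEvt μ (Y w) M {ω' | U ω' = u}| ≤ R ∧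
          (n : ℝ) ^ 2 - R ≤ hcs μ M U (M ω) u ∧
          |hcs μ M U (M ω) u - hs μ M (M ω)| ≤ R} {ω | U ω = u})) ∧
    ((∀ m : 𝓜, pr μ {ω | M ω = m} = 1 / (Fintype.card 𝓜 : ℝ)) →
      ∀ w : Channel 𝒳 𝒴, 1 - 8 * 2 ^ (-(n : ℝ) * ε) ≤
      cpr μ {ω | |(-Real.logb 2 (cpr μ {ω' | Y w ω' = Y w ω}
            ({ω' | M ω' = M ω} ∩ {ω' | U ω' = u}))) - HcEvt μ (Y w) M {ω' | U ω' = u}| ≤ R ∧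
          |hcs μ M U (M ω) u - Real.logb 2 (Fintype.card 𝓜)| ≤ R ∧
          |hcs μ M U (M ω) u - hs μ M (M ω)| ≤ R} {ω | U ω = u}) := by
  have hs_nonneg : ∀ m, 0 ≤ hs μ M m := fun m =>
    neg_nonneg.2 (Real.logb_nonpos one_lt_two (pr_nonneg μ _)
      (pr_univ (μ := μ) ▸ pr_mono μ (Set.subset_univ _)))
  constructor
  · by_cases hlt : (b : ℕ) < n ^ 2
    · left
      refine le_cpr_spectrum hloc hf hΔ hε hη0 hR
        (Q := fun m => |hcs μ M U m u - HEvt μ M {ω' | U ω' = u}| ≤ R)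
        fun w W' κ h m hm hup hlow hR' hρ => ?_
      have hwin : ∀ m, 0 < inMass (jointMass μ M X {ω | U ω = u}) m →
          (b : ℝ) ≤ hs μ M m ∧ hs μ M m ≤ b + 1 := fun m hm => by
        have := binIndex_one_of_lt (K := n ^ 2) (hs_nonneg m) (by rwa [hb m hm])
        rwa [hb m hm] at this
      have hH := h.msgEntropy_bounds (k := b) (δ := 1) (fun m hm => by
        have := hwin m hm
        rwa [hs, ← Set.inter_univ {ω | M ω = m}, ← inMass_jointMass (X := X)] at this)
      rw [msgEntropy_eq] at hH
      have := hwin m hm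
      rw [abs_le]
      constructor <;> linarith
    · right
      refine le_cpr_spectrum hloc hf hΔ hε hη0 hR (Q := fun m => (n : ℝ) ^ 2 - R ≤ hcs μ M U m u)
        fun w W' κ h m hm hup hlow hR' hρ => ?_
      have := binIndex_one_of_ge (K := n ^ 2) (hs_nonneg m) (by rwa [hb m hm])
      push_cast at this
      linarith
  · intro hunif
    refine le_cpr_spectrum hloc hf hΔ hε hη0 hR
      (Q := fun m => |hcs μ M U m u - Real.logb 2 (Fintype.card 𝓜)| ≤ R)
      fun w W' κ h m hm hup hlow hR' hρ => ?_
    have : hs μ M m = Real.logb 2 (Fintype.card 𝓜) := by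
      rw [hs, hunif, one_div, Real.logb_inv, neg_neg]
    rw [abs_le]
    constructor <;> linarith

lemma logb_card_labels (l N n : ℕ) :
    Real.logb 2 (Fintype.card (Fin l → ((𝒳 → 𝒴 → Fin (N + 1)) → Fin (N + 1)) ×
      Fin (n ^ 2 + 1))) = l * labelBits (Fintype.card 𝒳 * Fintype.card 𝒴) N n := by
  rw [← Nat.card_eq_fintype_card (α := Fin l → _)]
  simp only [Nat.card_fun, Nat.card_prod]
  simp only [Nat.card_eq_fintype_card, Fintype.card_fin]
  push_cast
  rw [Real.logb_pow, Real.logb_mul (by positivity) (by positivity), Real.logb_pow, labelBits]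
  push_cast
  rw [mul_comm (Fintype.card 𝒳), pow_mul]

end Stabilizer

section Labels

variable {μ : PMF Ω} {𝓜 𝒳 𝒴 : Type*} [Fintype 𝒳] [Fintype 𝒴] [Nonempty 𝒴] {n : ℕ}

/-- The bins of the mean output spectra over all grid channels, and of the message spectrum. -/
def binLabel (𝒴 : Type*) [Fintype 𝒴] [Nonempty 𝒴] (μ : PMF Ω) (M : Ω → 𝓜)
    (X : Ω → Fin n → 𝒳) (N : ℕ) (Δ : ℝ) (m : 𝓜) (x : Fin n → 𝒳) :
    ((𝒳 → 𝒴 → Fin (N + 1)) → Fin (N + 1)) × Fin (n ^ 2 + 1) :=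
  (fun a => binIndex N Δ (prodExp (fun i => (gridChannel a).w (x i))
    (spec (gridChannel a) (jointMass μ M X Set.univ) m)), binIndex (n ^ 2) 1 (hs μ M m))

lemma exists_isLocalized_of_binLabel [Fintype 𝓜] {M : Ω → 𝓜} {X : Ω → Fin n → 𝒳} {N : ℕ}
    {s : ℝ} {E : Set Ω} {b : ((𝒳 → 𝒴 → Fin (N + 1)) → Fin (N + 1)) × Fin (n ^ 2 + 1)}
    (hn : 0 < n) (hN : 0 < N) (hs : 1 ≤ N * s) (hE : 0 < pr μ E)
    (hb : ∀ ω ∈ E, binLabel 𝒴 μ M X N (n * Real.logb 2 (N + Fintype.card 𝒴) * s)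
      (M ω) (X ω) = b) (W : Channel 𝒳 𝒴) :
    ∃ (W' : Channel 𝒳 𝒴) (κ : ℝ), IsLocalized W W' (jointMass μ M X Set.univ)
      (jointMass μ M X E) (N + Fintype.card 𝒴) (Fintype.card 𝒴 / (N + Fintype.card 𝒴))
      (pr μ E) κ (n * Real.logb 2 (N + Fintype.card 𝒴) * s) := by
  obtain ⟨a, ha, ha'⟩ := exists_gridChannel_near hN W
  have hn' : (0 : ℝ) < n := by exact_mod_cast hn
  have hN' : (1 : ℝ) ≤ N := by exact_mod_cast hN
  have hk : (1 : ℝ) ≤ Fintype.card 𝒴 := by exact_mod_cast Fintype.card_pos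
  have hD : (1 : ℝ) < N + Fintype.card 𝒴 := by linarith
  have hL : 0 < Real.logb 2 (N + Fintype.card 𝒴) := Real.logb_pos one_lt_two hD
  have hs0 : 0 < s := pos_of_mul_pos_right (one_pos.trans_le hs) (by linarith)
  refine ⟨gridChannel a, (b.1 a : ℝ) * (n * Real.logb 2 (N + Fintype.card 𝒴) * s), ?_⟩
  refine
    { one_lt_D := hD
      inv_D_le := ha
      η_lt_one := by rw [div_lt_one (by linarith)]; linarith
      le_W' := ha'
      r_nonneg := jointMass_nonneg
      r_le := jointMass_le_univ
      sum_p_le := by rw [sum_jointMass, pr_univ]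
      sum_r := sum_jointMass
      ρ_pos := hE
      window := fun m x hr => ?_ }
  obtain ⟨ω, hω, rfl, rfl⟩ := exists_of_jointMass_pos hr
  have hp : 0 < jointMass μ M X Set.univ (M ω) (X ω) := hr.trans_le (jointMass_le_univ _ _)
  have hin := inMass_pos_of_pos jointMass_nonneg hp
  have hw := (gridChannel a).isWeights (X ω)
  have h0 := prodExp_mono hw (spec_nonneg (W := gridChannel a)
    (jointMass_nonneg (μ := μ) (M := M) (X := X) (E := Set.univ)) (M ω))
  have h1 := prodExp_mono hw fun y => spec_le (one_pos.trans hD) ha jointMass_nonneg hin y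
  rw [prodExp_const hw] at h0 h1
  have h2 : (n : ℝ) * Real.logb 2 (N + Fintype.card 𝒴) * 1 ≤
      n * Real.logb 2 (N + Fintype.card 𝒴) * (N * s) := by gcongr
  have hΔ : 0 < n * Real.logb 2 (N + Fintype.card 𝒴) * s := by positivity
  have := binIndex_window (K := N) hΔ h0 (by linarith)
  rwa [← hb ω hω]

end Labels

/-- Corollary `cor:mt`. -/
theorem exists_simultaneous_stabilizer (c𝒳 c𝒴 : ℕ) (h2X : 2 ≤ c𝒳) (h2Y : 2 ≤ c𝒴) :
    ∃ C : ℝ, 0 < C ∧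
      ∀ (𝒳 𝒴 : Type) [Fintype 𝒳] [Fintype 𝒴],
        Fintype.card 𝒳 = c𝒳 → Fintype.card 𝒴 = c𝒴 →
      ∀ (n : ℕ), 27 ≤ n →
      ∀ εn : ℝ, εn = (n : ℝ) ^ (-(1 : ℝ) / ((c𝒳 : ℝ) * (c𝒴 : ℝ) + 1)) →
      ∀ l : ℕ, 0 < l →
      ∀ (Ω : Type) (μ : PMF Ω) (𝓜 : Fin l → Type) [∀ j, Fintype (𝓜 j)]
        (M : ∀ j, Ω → 𝓜 j) (𝒯 : Type) [Fintype 𝒯] (T : Ω → 𝒯)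
        (X : Ω → Fin n → 𝒳) (Y : Channel 𝒳 𝒴 → Ω → Fin n → 𝒴),
        (∀ w, IsOutput μ X (Y w) w) →
        (∀ w, Markov μ (fun ω => (T ω, fun j => M j ω)) X (Y w)) →
      ∃ (𝒰 : Type) (_ : Fintype 𝒰) (U : Ω → 𝒰) (ν : ℝ) (Ut : Set 𝒰),
        (∃ g : 𝒰 → 𝒯, pr μ {ω | T ω = g (U ω)} = 1) ∧
        (∀ w, Markov μ (fun ω => (U ω, fun j => M j ω)) X (Y w)) ∧
        Real.logb 2 (suppCard μ U) ≤
          C * (Real.logb 2 (suppCard μ T) +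
            (l : ℝ) * n * εn * (- Real.logb 2 εn)) ∧
        0 < ν ∧
        ν ≤ C * ((1 / n) * Real.logb 2 (suppCard μ T) +
          (l : ℝ) * Real.sqrt εn * (- Real.logb 2 εn)) ∧
        1 - C * l * 2 ^ (-(n : ℝ) * εn) ≤ pr μ {ω | U ω ∈ Ut} ∧
        ∀ j : Fin l, ∀ u ∈ Ut,
          ((∀ w : Channel 𝒳 𝒴,
              1 - 8 * 2 ^ (-(n : ℝ) * εn) ≤
                cpr μ
                  {ω | |(- Real.logb 2 (cpr μ {ω' | Y w ω' = Y w ω}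
                          ({ω' | M j ω' = M j ω} ∩ {ω' | U ω' = u}))) -
                        HcEvt μ (Y w) (M j) {ω' | U ω' = u}| ≤ n * ν ∧
                    |hcs μ (M j) U (M j ω) u - HEvt μ (M j) {ω' | U ω' = u}| ≤ n * ν ∧
                    |hcs μ (M j) U (M j ω) u - hs μ (M j) (M j ω)| ≤ n * ν}
                  {ω | U ω = u}) ∨
            (∀ w : Channel 𝒳 𝒴,
              1 - 8 * 2 ^ (-(n : ℝ) * εn) ≤
                cpr μ
                  {ω | |(- Real.logb 2 (cpr μ {ω' | Y w ω' = Y w ω}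
                          ({ω' | M j ω' = M j ω} ∩ {ω' | U ω' = u}))) -
                        HcEvt μ (Y w) (M j) {ω' | U ω' = u}| ≤ n * ν ∧
                    (n : ℝ) ^ 2 - n * ν ≤ hcs μ (M j) U (M j ω) u ∧
                    |hcs μ (M j) U (M j ω) u - hs μ (M j) (M j ω)| ≤ n * ν}
                  {ω | U ω = u})) ∧
          ((∀ m : 𝓜 j, pr μ {ω | M j ω = m} = 1 / (Fintype.card (𝓜 j) : ℝ)) →
            ∀ w : Channel 𝒳 𝒴,
              1 - 8 * 2 ^ (-(n : ℝ) * εn) ≤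
                cpr μ
                  {ω | |(- Real.logb 2 (cpr μ {ω' | Y w ω' = Y w ω}
                          ({ω' | M j ω' = M j ω} ∩ {ω' | U ω' = u}))) -
                        HcEvt μ (Y w) (M j) {ω' | U ω' = u}| ≤ n * ν ∧
                    |hcs μ (M j) U (M j ω) u -
                      Real.logb 2 (Fintype.card (𝓜 j))| ≤ n * ν ∧
                    |hcs μ (M j) U (M j ω) u - hs μ (M j) (M j ω)| ≤ n * ν}
                  {ω | U ω = u}) := by
  obtain ⟨C, hC1, hC⟩ := exists_constant (c𝒳 * c𝒴) c𝒴
  refine ⟨C, by linarith, ?_⟩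
  rintro 𝒳 𝒴 _ _ rfl rfl n hn εn hεn l hl Ω μ 𝓜 _ M 𝒯 _ T X Y hout hmk
  have : Nonempty 𝒴 := Fintype.card_pos_iff.1 (by omega)
  obtain ⟨hε, N, hN, hNε, hbd⟩ := hC n hn εn (by rw [hεn]; push_cast; rfl)
  have hτ : 0 ≤ Real.logb 2 (suppCard μ T) :=
    Real.logb_nonneg one_lt_two (by exact_mod_cast suppCard_pos T)
  obtain ⟨hU, hν, hR⟩ := hbd l hl _ hτ
  have hN1 : (1 : ℝ) ≤ N := by exact_mod_cast hN
  have hL : 0 ≤ Real.logb 2 ((N : ℝ) + Fintype.card 𝒴) := Real.logb_nonneg one_lt_two (by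
    have : (0 : ℝ) ≤ Fintype.card 𝒴 := Nat.cast_nonneg _
    linarith)
  set Δ : ℝ := n * Real.logb 2 ((N : ℝ) + Fintype.card 𝒴) * √εn
  set f : 𝒯 × (∀ j, 𝓜 j) → (Fin n → 𝒳) →
      𝒯 × (Fin l → ((𝒳 → 𝒴 → Fin (N + 1)) → Fin (N + 1)) × Fin (n ^ 2 + 1)) :=
    fun v x => (v.1, fun j => binLabel 𝒴 μ (M j) X N Δ (v.2 j) x)
  set U := fun ω => f (T ω, fun j => M j ω) (X ω)
  have hS : (0 : ℝ) < suppCard μ U := by exact_mod_cast suppCard_pos U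
  have hSU : Real.logb 2 (suppCard μ U) ≤ Real.logb 2 (suppCard μ T) +
      l * labelBits (Fintype.card 𝒳 * Fintype.card 𝒴) N n := by
    rw [← logb_card_labels, ← Real.logb_mul (by exact_mod_cast (suppCard_pos T).ne')
      (by exact_mod_cast Fintype.card_ne_zero)]
    refine Real.logb_le_logb_of_le one_lt_two hS ?_
    exact_mod_cast suppCard_prod_le T fun ω j => binLabel 𝒴 μ (M j) X N Δ (M j ω) (X ω)
  refine ⟨_, inferInstance, U, C * (1 / n * Real.logb 2 (suppCard μ T) +
    l * √εn * -Real.logb 2 εn),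
    {u | 2 ^ (-(n : ℝ) * εn) / suppCard μ U ≤ pr μ {ω | U ω = u}},
    ⟨Prod.fst, ?_⟩, fun w => ?_, hSU.trans hU, hν, le_rfl, ?_, fun j u hu => ?_⟩
  · rw [← pr_univ (μ := μ)]
    congr 1
    exact Set.eq_univ_of_forall fun ω => rfl
  · exact Markov.of_comp (hout w) (hmk w) fun v x => (f v x, v.2)
  · refine le_trans ?_ (one_sub_le_pr_likely U (by positivity))
    have h1 : (0 : ℝ) < 2 ^ (-(n : ℝ) * εn) := by positivity
    have h2 : (1 : ℝ) ≤ l := by exact_mod_cast hl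
    have h3 : 1 ≤ C * l := one_le_mul_of_one_le_of_one_le hC1 h2
    nlinarith
  · have hpos : 0 < pr μ {ω | U ω = u} := lt_of_lt_of_le (by positivity) hu
    have hlog : -Real.logb 2 (pr μ {ω | U ω = u}) ≤ Real.logb 2 (suppCard μ T) +
        l * labelBits (Fintype.card 𝒳 * Fintype.card 𝒴) N n + n * εn := by
      have := Real.logb_le_logb_of_le one_lt_two (by positivity) hu
      rw [Real.logb_div (by positivity) hS.ne', Real.logb_rpow two_pos (by norm_num)] at this
      linarith
    refine stable_or_saturated (exists_isLocalized_of_binLabel (by omega) hN hNε hpos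
        (b := u.2 j) fun ω hω => congrFun (congrArg Prod.snd hω) j)
      (fun w => (hmk w).factorsThrough (hout w) f u j) (by positivity) hε.le (by positivity)
      (by linarith) (u.2 j).2 fun m hm => ?_
    obtain ⟨x, -, hx⟩ := Finset.exists_lt_of_sum_lt (s := Finset.univ) (f := fun _ => (0 : ℝ))
      (by simpa [inMass] using hm)
    obtain ⟨ω, hω, rfl, -⟩ := exists_of_jointMass_pos hx
    exact congrArg (fun v => (v.2 j).2) hω

end Paper
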